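/- arXiv:2404.09594 — 7 statements merged into one kernel-verified Lean document; each statement's English description precedes it below -/
import Mathlib

section
/- Let m ≥ 8 be an integer such that m ≡ 0 (mod 4) and m−1 belongs to the set 𝓜. Then there exists N (depending only on m) such that for all n ≥ N, no polynomial f(x) = a₀x^m + a₁x^{m−1} + a₂x^{m−2} ∈ 𝔽_{2ⁿ}[x] of degree m with a₁ ≠ 0 is almost perfect nonlinear over 𝔽_{2ⁿ}; in particular no such polynomial is exceptional APN. -/
open Polynomial

/-- Membership in the set `𝓜` of odd positive integers `m` such that for all `ζ₁, ζ₂` in the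
algebraic closure of `𝔽₂` with `ζ₁ ≠ 1` and `ζ₂ ≠ 1`, the conditions
`ζ₁ ^ (m-1) = ζ₂ ^ (m-1) = ((1+ζ₁)/(1+ζ₂)) ^ (m-1) = 1` imply `ζ₁ = ζ₂` or `ζ₁ = ζ₂⁻¹`. -/
def InM (m : ℕ) : Prop :=
  Odd m ∧ 0 < m ∧
    ∀ ζ₁ ζ₂ : AlgebraicClosure (ZMod 2), ζ₁ ≠ 1 → ζ₂ ≠ 1 →
      ζ₁ ^ (m - 1) = 1 → ζ₂ ^ (m - 1) = 1 →
      ((1 + ζ₁) / (1 + ζ₂)) ^ (m - 1) = 1 →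
      ζ₁ = ζ₂ ∨ ζ₁ = ζ₂⁻¹

/-- The differential uniformity of a polynomial `f` over a field `F`: the maximum, over
`α ∈ F \ {0}` and `β ∈ F`, of the number of solutions `x ∈ F` of `f(x+α) - f(x) = β`. -/
noncomputable def diffUnif {F : Type*} [Field F] (f : F[X]) : ℕ :=
  sSup {k : ℕ | ∃ α : F, α ≠ 0 ∧ ∃ β : F,
    k = Nat.card {x : F // f.eval (x + α) - f.eval x = β}}

/-- A polynomial is almost perfect nonlinear (APN) if its differential uniformity is `2`. -/
noncomputable def IsAPN {F : Type*} [Field F] (f : F[X]) : Prop :=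
  diffUnif f = 2

/-- A polynomial over `𝔽_{2^n}` is exceptional APN if it is APN over infinitely many
extensions of `𝔽_{2^n}` (extensions are fields `𝔽_{2^k}` admitting an embedding of
`𝔽_{2^n}`, i.e. with `n ∣ k`). -/
noncomputable def IsExceptionalAPN (n : ℕ) (f : Polynomial (GaloisField 2 n)) : Prop :=
  {k : ℕ | ∃ φ : GaloisField 2 n →+* GaloisField 2 k, IsAPN (f.map φ)}.Infinite

lemma sum_X_sub_C_pow_mul_ne_zero {K ι : Type*} [Field K] (θ : K) (s : Finset ι)
    (hs : s.Nonempty) (e : ι → ℕ) (he : Set.InjOn e s) (g : ι → K[X])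
    (hg : ∀ j ∈ s, (g j).eval θ ≠ 0) :
    ∑ j ∈ s, (X - C θ) ^ e j * g j ≠ 0 := by
  classical
  intro h0
  obtain ⟨j₀, hj₀, hmin⟩ := s.exists_min_image e hs
  rw [← Finset.add_sum_erase s _ hj₀] at h0
  have hdvd : (X - C θ) ^ (e j₀ + 1) ∣ ∑ j ∈ s.erase j₀, (X - C θ) ^ e j * g j := by
    refine Finset.dvd_sum fun j hj => ?_
    obtain ⟨hne, hjs⟩ := Finset.mem_erase.mp hj
    have hlt : e j₀ < e j :=
      lt_of_le_of_ne (hmin j hjs) fun h => hne (he hjs hj₀ h.symm)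
    exact (pow_dvd_pow _ hlt).mul_right _
  have h1 : (X - C θ) ^ (e j₀ + 1) ∣ (X - C θ) ^ e j₀ * g j₀ := by
    rw [eq_neg_of_add_eq_zero_left h0]
    exact (dvd_neg).mpr hdvd
  rw [pow_succ] at h1
  have h2 := (mul_dvd_mul_iff_left (pow_ne_zero _ (X_sub_C_ne_zero θ))).mp h1
  exact hg j₀ hj₀ (dvd_iff_isRoot.mp h2)

lemma exists_ne_zero_sum_mul_eq_zero {K ι : Type*} [Field K] [Fintype ι] (M : ι → K[X])
    (E m : ℕ) (hM : ∀ i, (M i).natDegree ≤ E) (hcard : E + m < Fintype.card ι * m) :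
    ∃ c : ι → K[X], c ≠ 0 ∧ (∀ i, (c i).degree < m) ∧ ∑ i, c i * M i = 0 := by
  let φ : (ι → degreeLT K m) →ₗ[K] K[X] :=
    ∑ i, (LinearMap.mulRight K (M i)) ∘ₗ (degreeLT K m).subtype ∘ₗ LinearMap.proj i
  have hφ : ∀ c, φ c = ∑ i, (c i : K[X]) * M i := by
    intro c; simp [φ, LinearMap.sum_apply]
  have hmem : ∀ c, φ c ∈ degreeLT K (E + m) := by
    intro c
    rw [hφ]
    refine Submodule.sum_mem _ fun i _ => ?_
    rw [mem_degreeLT]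
    by_cases hc : (c i : K[X]) = 0
    · rw [hc, zero_mul, degree_zero]; exact WithBot.bot_lt_coe _
    have h1 := mem_degreeLT.mp (c i).2
    rw [degree_eq_natDegree hc] at h1
    have h1' : (c i : K[X]).natDegree < m := by exact_mod_cast h1
    refine lt_of_le_of_lt degree_le_natDegree ?_
    have := (natDegree_mul_le (p := (c i : K[X])) (q := M i))
    have h2 := hM i
    exact_mod_cast (by omega : ((c i : K[X]) * M i).natDegree < E + m)
  let ψ := φ.codRestrict _ hmem
  have hfin : ∀ j, Module.finrank K (degreeLT K j) = j := fun j => by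
    rw [(degreeLTEquiv K j).finrank_eq]; simp
  have : ∀ j, FiniteDimensional K (degreeLT K j) := fun j =>
    (degreeLTEquiv K j).symm.finiteDimensional
  have hker : LinearMap.ker ψ ≠ ⊥ := by
    apply LinearMap.ker_ne_bot_of_finrank_lt
    rw [Module.finrank_pi_fintype]
    simp only [hfin]
    simpa using hcard
  obtain ⟨c, hc, hc0⟩ := (Submodule.ne_bot_iff _).mp hker
  refine ⟨fun i => c i, ?_, fun i => mem_degreeLT.mp (c i).2, ?_⟩
  · intro h
    apply hc0
    ext1 i
    exact Subtype.ext (congrFun h i)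
  · rw [← hφ]
    exact congrArg Subtype.val (LinearMap.mem_ker.mp hc)

/-- The partial trace `∑_{i < j} (N / D) ^ (2 ^ i)`, with denominators cleared by `D ^ (2 ^ j)`. -/
noncomputable def clearedTrace {K : Type*} [Field K] (N D : K[X]) (j : ℕ) : K[X] :=
  ∑ i ∈ Finset.range j, N ^ 2 ^ i * D ^ (2 ^ j - 2 ^ i)

lemma natDegree_clearedTrace_le {K : Type*} [Field K] {N D : K[X]} {d : ℕ}
    (hN : N.natDegree ≤ d) (hD : D.natDegree ≤ d) (j : ℕ) :
    (clearedTrace N D j).natDegree ≤ d * 2 ^ j := by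
  refine natDegree_sum_le_of_forall_le _ _ fun i hi => ?_
  have hij : 2 ^ i ≤ 2 ^ j := Nat.pow_le_pow_right (by norm_num) (Finset.mem_range.mp hi).le
  calc (N ^ 2 ^ i * D ^ (2 ^ j - 2 ^ i)).natDegree
      ≤ (N ^ 2 ^ i).natDegree + (D ^ (2 ^ j - 2 ^ i)).natDegree := natDegree_mul_le
    _ ≤ 2 ^ i * d + (2 ^ j - 2 ^ i) * d :=
        add_le_add (natDegree_pow_le_of_le _ hN) (natDegree_pow_le_of_le _ hD)
    _ = d * 2 ^ j := by rw [← add_mul, Nat.add_sub_cancel' hij, mul_comm]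

lemma eval_clearedTrace {K : Type*} [Field K] (N D : K[X]) (j : ℕ) {u : K} (hu : D.eval u ≠ 0) :
    (clearedTrace N D j).eval u =
      D.eval u ^ 2 ^ j * ∑ i ∈ Finset.range j, (N.eval u / D.eval u) ^ 2 ^ i := by
  rw [clearedTrace, eval_finsetSum, Finset.mul_sum]
  refine Finset.sum_congr rfl fun i hi => ?_
  have hij : 2 ^ i ≤ 2 ^ j := Nat.pow_le_pow_right (by norm_num) (Finset.mem_range.mp hi).le
  rw [eval_mul, eval_pow, eval_pow, div_pow, pow_sub₀ _ hu hij]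
  field_simp

lemma clearedTrace_succ_eq {K : Type*} [Field K] (N D : K[X]) (j : ℕ) {θ : K}
    (hD : D.eval θ = 0) (hD' : D.derivative.eval θ ≠ 0) (hN : N.eval θ ≠ 0) :
    ∃ g : K[X], g.eval θ ≠ 0 ∧ clearedTrace N D (j + 1) = (X - C θ) ^ 2 ^ j * g := by
  obtain ⟨D₁, hD₁⟩ := dvd_iff_isRoot.mpr hD
  have hD₁θ : D₁.eval θ ≠ 0 := by
    rw [hD₁] at hD'
    simpa using hD'
  have hdvd : (X - C θ) ^ (2 ^ j + 1) ∣
      ∑ i ∈ Finset.range j, N ^ 2 ^ i * D ^ (2 ^ (j + 1) - 2 ^ i) := by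
    refine Finset.dvd_sum fun i hi => ?_
    have hij : 2 ^ i < 2 ^ j := Nat.pow_lt_pow_right (by norm_num) (Finset.mem_range.mp hi)
    refine Dvd.dvd.mul_left ?_ _
    refine (pow_dvd_pow (X - C θ) (?_ : _ ≤ 2 ^ (j + 1) - 2 ^ i)).trans
      (pow_dvd_pow_of_dvd ⟨D₁, hD₁⟩ _)
    rw [pow_succ]; omega
  obtain ⟨r, hr⟩ := hdvd
  refine ⟨(X - C θ) * r + N ^ 2 ^ j * D₁ ^ 2 ^ j, ?_, ?_⟩
  · simp [hN, hD₁θ]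
  · rw [clearedTrace, Finset.sum_range_succ, hr]
    have : 2 ^ (j + 1) - 2 ^ j = 2 ^ j := by rw [pow_succ]; omega
    rw [this]
    nth_rw 1 [hD₁]
    rw [mul_pow]
    ring

lemma add_mul_inj_of_lt {P i i' a a' : ℕ} (hi : i < P) (hi' : i' < P)
    (h : i + P * a = i' + P * a') : i = i' ∧ a = a' := by
  have h1 : i = i' := by
    have := congrArg (· % P) h
    simpa [Nat.add_mul_mod_self_left, Nat.mod_eq_of_lt hi, Nat.mod_eq_of_lt hi'] using this
  subst h1
  exact ⟨rfl, Nat.eq_of_mul_eq_mul_left (by omega) (Nat.add_left_cancel h)⟩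

/-- Let `θ` be a simple pole of `N / D`.  Then the trace of `N / D` takes a given value at not
much more than half of the points of the field with `2 ^ n` elements. -/
lemma card_trace_eq_le {K : Type*} [Field K] [IsAlgClosed K] [CharP K 2] {d n : ℕ}
    (hn : 2 * d + 20 ≤ n) {N D : K[X]} (hNd : N.natDegree ≤ d) (hDd : D.natDegree ≤ d) {θ : K}
    (hD : D.eval θ = 0) (hD' : D.derivative.eval θ ≠ 0) (hN : N.eval θ ≠ 0)
    {ε : K} (hε : ε ^ 2 = ε) (U : Finset K)
    (hU : ∀ u ∈ U, u ^ 2 ^ n = u ∧ D.eval u ≠ 0 ∧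
      ∑ i ∈ Finset.range n, (N.eval u / D.eval u) ^ 2 ^ i = ε) :
    32 * U.card ≤ 19 * 2 ^ n := by
  classical
  obtain ⟨t, ht⟩ : ∃ t, n = (t + 1) + (d + 6) := ⟨n - d - 7, by omega⟩
  set Q := 2 ^ (t + 1) with hQ
  set Q' := 2 ^ (d + 6) with hQ'
  have hq : 2 ^ n = Q' * Q := by rw [ht, pow_add, mul_comm]
  have hd2 : d + 1 ≤ 2 ^ d := Nat.lt_two_pow_self
  have hQ'd : Q' = 64 * 2 ^ d := by rw [hQ', pow_add]; norm_num; ring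
  have hQP : Q = 2 * 2 ^ t := by rw [hQ, pow_succ]; ring
  have htd : 8 * (d + 1) ≤ 2 ^ t := by
    calc 8 * (d + 1) ≤ 2 ^ 3 * 2 ^ d := Nat.mul_le_mul (by norm_num) hd2
      _ = 2 ^ (3 + d) := (pow_add _ _ _).symm
      _ ≤ 2 ^ t := Nat.pow_le_pow_right (by norm_num) (by omega)
  have hεpow : ∀ j, ε ^ 2 ^ j = ε := by
    intro j
    induction j with
    | zero => simp
    | succ j ih => rw [pow_succ, pow_mul, ih, hε]
  obtain ⟨θ', hθ'⟩ := IsAlgClosed.exists_pow_nat_eq θ (n := 2 ^ n) (by positivity)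
  let A : Bool → K[X] := fun b => if b then clearedTrace N D (t + 1) else D ^ Q
  let B : Bool → K[X] := fun b =>
    if b then clearedTrace N D (d + 6) + C ε * D ^ Q' else D ^ Q'
  have hDpow : ∀ j, (D ^ j).natDegree ≤ d * j := fun j => by
    rw [mul_comm]; exact natDegree_pow_le_of_le _ hDd
  have hAdeg : ∀ b, (A b).natDegree ≤ d * Q := by
    rintro (_ | _)
    · exact hDpow Q
    · exact natDegree_clearedTrace_le hNd hDd _
  have hBdeg : ∀ b, (B b).natDegree ≤ d * Q' := by
    rintro (_ | _)
    · exact hDpow Q'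
    · refine natDegree_add_le_of_degree_le (natDegree_clearedTrace_le hNd hDd _) ?_
      exact (natDegree_C_mul_le _ _).trans (hDpow Q')
  have hAB : ∀ u ∈ U, ∀ b, D.eval u ^ (2 ^ n) * (A b).eval u =
      D.eval u ^ Q * (B b).eval u ^ Q := by
    intro u hu b
    obtain ⟨-, hDu, htr⟩ := hU u hu
    rcases b with _ | _
    · simp only [A, B, Bool.false_eq_true, if_false, eval_pow]
      rw [hq, pow_mul]; ring
    · simp only [A, B, if_true, eval_add, eval_mul, eval_C, eval_pow]
      rw [eval_clearedTrace _ _ _ hDu, eval_clearedTrace _ _ _ hDu, mul_comm ε, ← mul_add,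
        mul_pow, hq, pow_mul, ← mul_assoc, ← mul_assoc, mul_comm (_ ^ Q)]
      congr 1
      rw [hQ, add_pow_char_pow, hεpow, ← htr, sum_pow_char_pow, ht,
        Finset.sum_range_add _ (t + 1) (d + 6)]
      simp_rw [← pow_mul, ← pow_add]
      have : ∑ i ∈ Finset.range (d + 6), (N.eval u / D.eval u) ^ 2 ^ (i + (t + 1)) =
          ∑ i ∈ Finset.range (d + 6), (N.eval u / D.eval u) ^ 2 ^ (t + 1 + i) :=
        Finset.sum_congr rfl fun i _ => by rw [add_comm]
      rw [this, add_left_comm (∑ i ∈ Finset.range (d + 6), _), CharTwo.add_self_eq_zero, add_zero]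
  obtain ⟨c, hc0, hcdeg, hcsum⟩ := exists_ne_zero_sum_mul_eq_zero
    (ι := Fin (8 * (d + 1)) × Bool) (fun j => (X - C θ') ^ (j.1 * Q') * B j.2)
    (8 * (d + 1) * Q' + d * Q') (9 * 2 ^ (d + 2)) (by
      rintro ⟨i, b⟩
      refine natDegree_mul_le.trans (add_le_add ?_ (hBdeg b))
      rw [natDegree_pow, natDegree_X_sub_C, mul_one]
      exact Nat.mul_le_mul_right _ i.2.le) (by
      rw [Fintype.card_prod, Fintype.card_fin, Fintype.card_bool, hQ'd, pow_add]
      nlinarith [Nat.two_pow_pos d])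
  let W : K[X] := ∑ j : Fin (8 * (d + 1)) × Bool,
    (X - C θ) ^ (j.1 : ℕ) * (c j ^ Q * A j.2)
  have hW : W ≠ 0 := by
    obtain ⟨D₁, hD₁⟩ := dvd_iff_isRoot.mpr hD
    have hD₁θ : D₁.eval θ ≠ 0 := by
      rw [hD₁] at hD'
      simpa using hD'
    obtain ⟨h, hhθ, hh⟩ := clearedTrace_succ_eq N D t hD hD' hN
    have hord : ∀ p : K[X], p ≠ 0 → ∃ o : ℕ, ∃ g : K[X], g.eval θ ≠ 0 ∧
        p = (X - C θ) ^ o * g := by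
      intro p hp
      obtain ⟨g, hg, hg'⟩ := exists_eq_pow_rootMultiplicity_mul_and_not_dvd p hp θ
      exact ⟨_, g, fun h => hg' (dvd_iff_isRoot.mpr h), hg⟩
    have hcj : ∀ j, ∃ o : ℕ, ∃ g : K[X], c j ≠ 0 → g.eval θ ≠ 0 ∧
        c j = (X - C θ) ^ o * g := by
      intro j
      by_cases hj : c j = 0
      · exact ⟨0, 0, fun h => absurd hj h⟩
      · obtain ⟨o, g, h⟩ := hord _ hj
        exact ⟨o, g, fun _ => h⟩
    choose o g hg using hcj
    let ν : Bool → ℕ := fun b => if b then 1 else 2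
    let a : Bool → K[X] := fun b => if b then h else D₁ ^ Q
    have ha : ∀ b, (a b).eval θ ≠ 0 := by
      rintro (_ | _)
      · simp [a, hD₁θ]
      · simpa [a] using hhθ
    have hAa : ∀ b, A b = (X - C θ) ^ (2 ^ t * ν b) * a b := by
      rintro (_ | _)
      · simp only [A, a, ν, Bool.false_eq_true, if_false]
        rw [mul_comm _ 2, ← hQP, ← mul_pow, ← hD₁]
      · simpa [A, a, ν] using hh
    have key := sum_X_sub_C_pow_mul_ne_zero θ (Finset.univ.filter fun j => c j ≠ 0)
      (by
        obtain ⟨j, hj⟩ := Function.ne_iff.mp hc0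
        exact ⟨j, by simpa using hj⟩)
      (fun j => (j.1 : ℕ) + 2 ^ t * (2 * o j + ν j.2))
      (by
        rintro ⟨i, b⟩ - ⟨i', b'⟩ - heq
        obtain ⟨h1, h2⟩ := add_mul_inj_of_lt (i.2.trans_le htd) (i'.2.trans_le htd) heq
        have hb : b = b' := by
          rcases b with _ | _ <;> rcases b' with _ | _ <;> simp [ν] at h2 ⊢ <;> omega
        rw [hb, Fin.ext h1])
      (fun j => g j ^ Q * a j.2)
      (by
        intro j hj
        have := (hg j (Finset.mem_filter.mp hj).2).1
        simp [this, ha])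
    intro hW0
    refine key (Eq.trans ?_ hW0)
    rw [Finset.sum_filter]
    refine Finset.sum_congr rfl fun j _ => ?_
    split_ifs with hj
    · conv_rhs => rw [(hg j hj).2, hAa]
      rw [mul_pow, ← pow_mul, hQP]
      ring
    · rw [not_not.mp hj, zero_pow (by positivity)]
      simp
  have hWdeg : W.natDegree ≤ 8 * (d + 1) + (Q * (9 * 2 ^ (d + 2)) + d * Q) := by
    refine natDegree_sum_le_of_forall_le _ _ fun j _ => ?_
    refine natDegree_mul_le.trans (add_le_add ?_ (natDegree_mul_le.trans
      (add_le_add (natDegree_pow_le_of_le _ ?_) (hAdeg _))))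
    · rw [natDegree_pow, natDegree_X_sub_C, mul_one]
      exact j.1.2.le
    · exact natDegree_le_of_degree_le (hcdeg j).le
  have hWU : ∀ u ∈ U, W.eval u = 0 := by
    intro u hu
    obtain ⟨huq, hDu, -⟩ := hU u hu
    have hshift : u - θ = (u - θ') ^ (Q' * Q) := by
      rw [← hq, sub_pow_char_pow, huq, hθ']
    have h1 : D.eval u ^ (2 ^ n) * W.eval u = D.eval u ^ Q *
        (∑ j : Fin (8 * (d + 1)) × Bool,
          c j * ((X - C θ') ^ ((j.1 : ℕ) * Q') * B j.2)).eval u ^ Q := by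
      simp only [W, eval_finsetSum]
      rw [hQ, sum_pow_char_pow, ← hQ, Finset.mul_sum, Finset.mul_sum]
      refine Finset.sum_congr rfl fun j _ => ?_
      simp only [eval_mul, eval_pow, eval_sub, eval_X, eval_C]
      have := hAB u hu j.2
      rw [hshift, mul_pow, mul_pow]
      linear_combination ((u - θ') ^ (Q' * Q)) ^ (j.1 : ℕ) * (c j).eval u ^ Q * this
    rw [hcsum, eval_zero, zero_pow (by positivity), mul_zero] at h1
    exact (mul_eq_zero.mp h1).resolve_left (pow_ne_zero _ hDu)
  have hcard : U.card ≤ W.natDegree := by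
    refine le_trans (Finset.card_le_card fun u hu => ?_)
      ((Multiset.toFinset_card_le _).trans (card_roots' W))
    rw [Multiset.mem_toFinset, mem_roots hW]
    exact hWU u hu
  have h4 : 2 ^ (d + 2) = 4 * 2 ^ d := by rw [pow_add]; norm_num; ring
  rw [h4] at hWdeg
  rw [hq, hQ'd]
  have h5 : (d + 1) * Q ≤ 2 ^ d * Q := Nat.mul_le_mul_right _ hd2
  have h6 : 2 ^ d * 8 ≤ 2 ^ d * Q := Nat.mul_le_mul_left _ (by omega)
  nlinarith

lemma pow_eq_one_of_isRoot {K : Type*} [Field K] [CharP K 2] {k : ℕ} {θ : K}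
    (hG : θ ^ (2 * k + 1) + (θ + 1) ^ (2 * k + 1) + 1 = 0) (hQ : θ ^ k + (θ + 1) ^ k = 0) :
    θ ^ (2 * k) = 1 ∧ (θ + 1) ^ (2 * k) = 1 := by
  have h2 : (2 : K) = 0 := CharTwo.two_eq_zero
  have h1 : (θ + 1) ^ k = θ ^ k := by linear_combination hQ - θ ^ k * h2
  have h3 : (θ + 1) ^ (2 * k) = θ ^ (2 * k) := by
    rw [mul_comm, pow_mul, pow_mul, h1]
  rw [pow_succ, pow_succ, h3] at hG
  have h4 : θ ^ (2 * k) = 1 := by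
    linear_combination hG - θ ^ (2 * k) * θ * h2 - h2
  exact ⟨h4, h3.trans h4⟩

lemma InM.sq_add_self_add_one_eq_zero {k : ℕ} (hM : InM (2 * k + 1))
    {θ : AlgebraicClosure (ZMod 2)} (hk : 0 < k)
    (hG : θ ^ (2 * k + 1) + (θ + 1) ^ (2 * k + 1) + 1 = 0) (hQ : θ ^ k + (θ + 1) ^ k = 0) :
    θ ^ 2 + θ + 1 = 0 := by
  have h2 : (2 : AlgebraicClosure (ZMod 2)) = 0 := CharTwo.two_eq_zero
  obtain ⟨h3, h4⟩ := pow_eq_one_of_isRoot hG hQ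
  have hθ0 : θ ≠ 0 := by
    rintro rfl
    rw [zero_pow (by omega)] at h3
    exact zero_ne_one h3
  have hθ1 : θ + 1 ≠ 0 := by
    intro h
    rw [h, zero_pow (by omega)] at h4
    exact zero_ne_one h4
  have hinv : (1 + θ) / (1 + (θ + 1)) = (θ + 1) / θ := by
    congr 1
    · ring
    · linear_combination h2
  rcases hM.2.2 θ (θ + 1) (fun h => hθ1 (by rw [h]; linear_combination h2)) (by simpa using hθ0)
    h3 h4 (by rw [hinv, div_pow, Nat.add_sub_cancel, h3, h4, div_one]) with h | h
  · simp at h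
  · have : θ * (θ + 1) = 1 := by
      nth_rw 1 [h]
      exact inv_mul_cancel₀ hθ1
    linear_combination this + h2

/-- The polynomial `X ^ j + (X + 1) ^ j + 1`. -/
noncomputable def diffPoly (K : Type*) [Field K] (j : ℕ) : K[X] := X ^ j + (X + 1) ^ j + 1

lemma eval_diffPoly {K : Type*} [Field K] (j : ℕ) (u : K) :
    (diffPoly K j).eval u = u ^ j + (u + 1) ^ j + 1 := by
  simp [diffPoly]

lemma natDegree_diffPoly_le {K : Type*} [Field K] (j : ℕ) : (diffPoly K j).natDegree ≤ j := by
  unfold diffPoly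
  compute_degree

lemma coeff_diffPoly {K : Type*} [Field K] {j : ℕ} (hj : 2 ≤ j) :
    (diffPoly K j).coeff (j - 1) = j := by
  have h1 : j - 1 ≠ j := by omega
  have h2 : j - 1 ≠ 0 := by omega
  rw [diffPoly, coeff_add, coeff_add, coeff_X_pow, if_neg h1, coeff_X_add_one_pow, coeff_one,
    if_neg h2, Nat.choose_symm_of_eq_add (show j = (j - 1) + 1 by omega), Nat.choose_one_right]
  simp

lemma diffPoly_ne_zero {K : Type*} [Field K] [CharP K 2] {j : ℕ} (hj : 2 ≤ j) (hodd : Odd j) :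
    diffPoly K j ≠ 0 := by
  intro h
  have := coeff_diffPoly (K := K) hj
  rw [h, coeff_zero, CharTwo.natCast_eq_ite, if_neg (Nat.not_even_iff_odd.mpr hodd)] at this
  exact zero_ne_one this

lemma natDegree_diffPoly_le_sub_one {K : Type*} [Field K] [CharP K 2] {j : ℕ} (hj : 1 ≤ j) :
    (diffPoly K j).natDegree ≤ j - 1 := by
  rw [natDegree_le_iff_coeff_eq_zero]
  intro i hi
  rcases (show j ≤ i by omega).eq_or_lt with rfl | h
  · simp [diffPoly, coeff_X_add_one_pow, coeff_one, show j ≠ 0 by omega,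
      CharTwo.add_self_eq_zero]
  · exact coeff_eq_zero_of_natDegree_lt ((natDegree_diffPoly_le j).trans_lt h)

lemma derivative_diffPoly {K : Type*} [Field K] [CharP K 2] (k : ℕ) :
    derivative (diffPoly K (2 * k + 1)) = (X ^ k + (X + 1) ^ k) ^ 2 := by
  have h2 : (2 : K) = 0 := CharTwo.two_eq_zero
  rw [CharTwo.add_sq]
  simp [diffPoly, derivative_pow, h2, ← pow_mul, mul_comm k]

lemma exists_isRoot_diffPoly {k : ℕ} (hk : Odd k) (hk5 : 5 ≤ k) (hM : InM (2 * k + 1)) :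
    ∃ θ : AlgebraicClosure (ZMod 2), (diffPoly _ (2 * k + 1)).eval θ = 0 ∧
      θ ^ k + (θ + 1) ^ k ≠ 0 ∧ θ ^ k + (θ + 1) ^ k ≠ 1 := by
  classical
  by_contra! hcon
  let K := AlgebraicClosure (ZMod 2)
  have h2 : (2 : K) = 0 := CharTwo.two_eq_zero
  have hk1 : (k : K) = 1 := by
    rw [CharTwo.natCast_eq_ite, if_neg (Nat.not_even_iff_odd.mpr hk)]
  have hG0 : diffPoly K (2 * k + 1) ≠ 0 := diffPoly_ne_zero (by omega) ⟨k, rfl⟩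
  have hR0 : diffPoly K k ≠ 0 := diffPoly_ne_zero (by omega) hk
  have hGdeg : 2 * k ≤ (diffPoly K (2 * k + 1)).roots.card := by
    rw [IsAlgClosed.card_roots_eq_natDegree]
    apply le_natDegree_of_ne_zero
    have := coeff_diffPoly (K := K) (show 2 ≤ 2 * k + 1 by omega)
    rw [Nat.add_sub_cancel] at this
    rw [this]
    rw [CharTwo.natCast_eq_ite, if_neg (by simp)]
    exact one_ne_zero
  have hRdeg : (diffPoly K k).roots.card ≤ k - 1 :=
    (card_roots' _).trans (natDegree_diffPoly_le_sub_one (by omega))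
  let Q : K[X] := X ^ k + (X + 1) ^ k
  have hQeval : ∀ θ, Q.eval θ = θ ^ k + (θ + 1) ^ k := fun θ => by simp [Q]
  have hQ0 : Q ≠ 0 := by
    intro h
    have h0 := hQeval 0
    rw [h, zero_pow (by omega)] at h0
    simp at h0
  have hmult : ∀ θ, (diffPoly K (2 * k + 1)).roots.count θ ≤ 2 * Q.rootMultiplicity θ + 1 := by
    intro θ
    have h1 := rootMultiplicity_sub_one_le_derivative_rootMultiplicity_of_ne_zero
      (diffPoly K (2 * k + 1)) θ (by rw [derivative_diffPoly]; exact pow_ne_zero 2 hQ0)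
    rw [derivative_diffPoly, pow_two,
      rootMultiplicity_mul (mul_ne_zero hQ0 hQ0)] at h1
    rw [count_roots]
    omega
  have hR : ∀ θ, θ ^ k + (θ + 1) ^ k = 1 →
      (diffPoly K (2 * k + 1)).roots.count θ ≤ (diffPoly K k).roots.count θ := by
    intro θ hθ
    have h1 : Q.rootMultiplicity θ = 0 :=
      rootMultiplicity_eq_zero (by rw [IsRoot, hQeval, hθ]; exact one_ne_zero)
    have h3 : 0 < (diffPoly K k).roots.count θ := by
      rw [Multiset.count_pos, mem_roots hR0, IsRoot, eval_diffPoly, hθ]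
      exact CharTwo.add_self_eq_zero _
    have := hmult θ
    omega
  have hroot : ∀ θ, 0 < (diffPoly K (2 * k + 1)).roots.count θ →
      θ ^ (2 * k + 1) + (θ + 1) ^ (2 * k + 1) + 1 = 0 := by
    intro θ hθ
    rwa [Multiset.count_pos, mem_roots hG0, IsRoot, eval_diffPoly] at hθ
  by_cases hex : ∃ θ : K, θ ^ (2 * k + 1) + (θ + 1) ^ (2 * k + 1) + 1 = 0 ∧
      θ ^ k + (θ + 1) ^ k = 0
  · obtain ⟨ω, hω, hωQ⟩ := hex
    have h3k : 3 ∣ k := by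
      have h1 := hM.sq_add_self_add_one_eq_zero (by omega) hω hωQ
      have h3 : ω ^ 3 = 1 := by linear_combination (ω - 1) * h1
      have hω1 : ω ≠ 1 := by
        rintro rfl
        apply one_ne_zero (α := K)
        linear_combination h1 - h2
      have hord : orderOf ω = 3 := orderOf_eq_prime h3 hω1
      have h4 : ω ^ (2 * k) = 1 := (pow_eq_one_of_isRoot hω hωQ).1
      have h5 := orderOf_dvd_of_pow_eq_one h4
      rw [hord] at h5
      omega
    let E : K[X] := X ^ 2 + X + 1
    have hEdeg : E.natDegree = 2 := by simp only [E]; compute_degree!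
    have hE0 : E ≠ 0 := by
      intro h
      rw [h] at hEdeg
      simp at hEdeg
    have hle : (diffPoly K (2 * k + 1)).roots ≤ (diffPoly K k).roots + 3 • E.roots := by
      rw [Multiset.le_iff_count]
      intro θ
      rw [Multiset.count_add, Multiset.count_nsmul]
      rcases Nat.eq_zero_or_pos ((diffPoly K (2 * k + 1)).roots.count θ) with h0 | hpos
      · omega
      by_cases hθ : θ ^ k + (θ + 1) ^ k = 0
      · have hEθ : 0 < E.roots.count θ := by
          rw [Multiset.count_pos, mem_roots hE0]
          simpa [E] using hM.sq_add_self_add_one_eq_zero (by omega) (hroot θ hpos) hθ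
        have h1 : Q.rootMultiplicity θ ≤ 1 := by
          by_contra! h
          have hd := ((one_lt_rootMultiplicity_iff_isRoot hQ0).mp h).2
          have hpow := (pow_eq_one_of_isRoot (hroot θ hpos) hθ).1
          have hθ0 : θ ≠ 0 := by
            rintro rfl
            rw [zero_pow (by omega)] at hpow
            exact zero_ne_one hpow
          have hd' : θ ^ (k - 1) + (θ + 1) ^ (k - 1) = 0 := by
            simpa [Q, derivative_pow, hk1] using hd
          obtain ⟨l, rfl⟩ : ∃ l, k = l + 1 := ⟨k - 1, by omega⟩
          rw [Nat.add_sub_cancel] at hd'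
          have h3 : (θ + 1) ^ l = 0 := by
            rw [pow_succ, pow_succ] at hθ
            linear_combination hθ - θ * hd'
          rw [h3, add_zero] at hd'
          exact hθ0 (eq_zero_of_pow_eq_zero hd')
        have := hmult θ
        omega
      · have := hR θ (hcon θ (by rw [eval_diffPoly]; exact hroot θ hpos) hθ)
        omega
    have h1 := Multiset.card_le_card hle
    rw [Multiset.card_add, Multiset.card_nsmul] at h1
    have h3 := card_roots' E
    obtain ⟨l, hl⟩ := hk
    omega
  · push Not at hex
    have hle : (diffPoly K (2 * k + 1)).roots ≤ (diffPoly K k).roots := by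
      rw [Multiset.le_iff_count]
      intro θ
      rcases Nat.eq_zero_or_pos ((diffPoly K (2 * k + 1)).roots.count θ) with h0 | hpos
      · omega
      · exact hR θ (hcon θ (by rw [eval_diffPoly]; exact hroot θ hpos) (hex θ (hroot θ hpos)))
    have := Multiset.card_le_card hle
    omega

lemma exists_eq_of_pow_card_eq {F K : Type*} [Field F] [Fintype F] [Field K] {n : ℕ}
    (hF : Fintype.card F = 2 ^ n) (φ : F →+* K) {w : K}
    (hw : w ^ 2 ^ n = w) : ∃ x, φ x = w := by
  have hprod := FiniteField.roots_X_pow_card_sub_X F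
  have hsplit : (X ^ Fintype.card F - X : F[X]) = (Finset.univ.val.map fun a => X - C a).prod := by
    have h1 := Fintype.one_lt_card (α := F)
    rw [← hprod, prod_multiset_X_sub_C_of_monic_of_roots_card_eq]
    · exact monic_X_pow_sub (by rw [degree_X]; exact_mod_cast h1)
    · rw [hprod, FiniteField.X_pow_card_sub_X_natDegree_eq F h1]
      rfl
  have h := congrArg (eval₂ φ w) hsplit
  rw [eval₂_sub, eval₂_X_pow, eval₂_X, hF, hw, sub_self, eval₂_multiset_prod] at h
  obtain ⟨y, hy, hy0⟩ := Multiset.mem_map.mp (Multiset.prod_eq_zero_iff.mp h.symm)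
  obtain ⟨x, -, rfl⟩ := Multiset.mem_map.mp hy
  refine ⟨x, ?_⟩
  rw [eval₂_sub, eval₂_X, eval₂_C, sub_eq_zero] at hy0
  exact hy0.symm

lemma sum_range_sq_add_self_pow {K : Type*} [Field K] [CharP K 2] (w : K) (j : ℕ) :
    ∑ i ∈ Finset.range j, (w ^ 2 + w) ^ 2 ^ i = w ^ 2 ^ j + w := by
  induction j with
  | zero => simp [CharTwo.add_self_eq_zero]
  | succ j ih =>
    rw [Finset.sum_range_succ, ih, add_pow_char_pow, ← pow_mul, ← pow_succ']
    linear_combination w ^ 2 ^ j * (CharTwo.two_eq_zero : (2 : K) = 0)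

lemma exists_sq_add_self_eq_or_trace_eq_one {F K : Type*} [Field F] [Fintype F] [Field K]
    [IsAlgClosed K] [CharP K 2] {n : ℕ} (hF : Fintype.card F = 2 ^ n) (φ : F →+* K) (z : F) :
    (∃ x : F, x ^ 2 + x = z) ∨ ∑ i ∈ Finset.range n, (φ z) ^ 2 ^ i = 1 := by
  have h2 : (2 : K) = 0 := CharTwo.two_eq_zero
  obtain ⟨w, hw⟩ : ∃ w : K, w ^ 2 + w = φ z := by
    obtain ⟨w, hw⟩ := IsAlgClosed.exists_root (X ^ 2 + X - C (φ z) : K[X]) (by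
      have : (X ^ 2 + X - C (φ z) : K[X]).degree = 2 := by compute_degree!
      rw [this]; decide)
    refine ⟨w, sub_eq_zero.mp ?_⟩
    simpa using hw
  have hq : (φ z) ^ 2 ^ n = φ z := by rw [← map_pow, ← hF, FiniteField.pow_card]
  have h3 : (w ^ 2 ^ n) ^ 2 + w ^ 2 ^ n = w ^ 2 + w := by
    rw [hw, ← hq, ← hw, add_pow_char_pow]
    ring
  have h4 : (w ^ 2 ^ n + w) * (w ^ 2 ^ n + w + 1) = 0 := by
    linear_combination h3 + (w + w ^ 2 + w * w ^ 2 ^ n) * h2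
  rw [← hw, sum_range_sq_add_self_pow]
  rcases mul_eq_zero.mp h4 with h | h
  · left
    obtain ⟨x, hx⟩ := exists_eq_of_pow_card_eq hF φ (w := w) (by linear_combination h - w * h2)
    refine ⟨x, φ.injective ?_⟩
    rw [map_add, map_pow, hx, hw]
  · right
    linear_combination h - h2

lemma card_filter_trace_eq_one_le {F K : Type*} [Field F] [Fintype F] [Field K] [IsAlgClosed K]
    [CharP K 2] {n d : ℕ} (hF : Fintype.card F = 2 ^ n) (φ : F →+* K) (hn : 2 * d + 20 ≤ n)
    {N D : K[X]} (hNd : N.natDegree ≤ d) (hDd : D.natDegree ≤ d) {θ : K}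
    (hD : D.eval θ = 0) (hD' : D.derivative.eval θ ≠ 0) (hN : N.eval θ ≠ 0) (U : Finset F)
    (hU : ∀ u ∈ U, D.eval (φ u) ≠ 0 ∧
      ∑ i ∈ Finset.range n, (N.eval (φ u) / D.eval (φ u)) ^ 2 ^ i = 1) :
    32 * U.card ≤ 19 * 2 ^ n := by
  classical
  rw [← Finset.card_image_of_injective U φ.injective]
  refine card_trace_eq_le hn hNd hDd hD hD' hN (one_pow 2) _ fun v hv => ?_
  obtain ⟨u, hu, rfl⟩ := Finset.mem_image.mp hv
  refine ⟨?_, hU u hu⟩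
  rw [← map_pow, ← hF, FiniteField.pow_card]

lemma card_le_card_filter_eval_ne_zero {F : Type*} [Field F] [Fintype F] [DecidableEq F] {p : F[X]}
    (hp : p ≠ 0) :
    Fintype.card F ≤ (Finset.univ.filter fun u => p.eval u ≠ 0).card + p.natDegree := by
  have h := Finset.card_filter_add_card_filter_not (s := (Finset.univ : Finset F))
    (fun u => p.eval u ≠ 0)
  rw [Finset.card_univ] at h
  rw [← h]
  refine Nat.add_le_add_left (le_trans (Finset.card_le_card fun u hu => ?_)
    ((Multiset.toFinset_card_le _).trans (card_roots' p))) _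
  rw [Multiset.mem_toFinset, mem_roots hp]
  simpa using hu

/-- Some derivative of `f` in a direction `α` takes the same value at `α * u` and `α * v`, where
`α * u` and `α * v` do not form a pair `{x, x + α}`. -/
def HasCollision {F : Type*} [Field F] (f : F → F) : Prop :=
  ∃ α u v : F, α ≠ 0 ∧ u ≠ v ∧ u ≠ v + 1 ∧
    f (α * u + α) + f (α * u) = f (α * v + α) + f (α * v)

lemma not_isAPN_of_hasCollision {F : Type*} [Field F] [Finite F] [CharP F 2] {f : F[X]}
    (h : HasCollision fun x => f.eval x) : ¬ IsAPN f := by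
  classical
  obtain ⟨α, u, v, hα, huv, huv1, h⟩ := h
  have h2 : (2 : F) = 0 := CharTwo.two_eq_zero
  have hbdd : BddAbove {k : ℕ | ∃ α : F, α ≠ 0 ∧ ∃ β : F,
      k = Nat.card {x : F // f.eval (x + α) - f.eval x = β}} := by
    refine ⟨Nat.card F, ?_⟩
    rintro k ⟨α, -, β, rfl⟩
    exact Finite.card_subtype_le _
  have hle := le_csSup hbdd ⟨α, hα, f.eval (α * u + α) - f.eval (α * u), rfl⟩
  change _ ≤ diffUnif f at hle
  have h3 : 3 ≤ Nat.card {x : F // f.eval (x + α) - f.eval x =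
      f.eval (α * u + α) - f.eval (α * u)} := by
    have hsub : (({α * u, α * u + α, α * v} : Finset F) : Set F) ⊆
        {x : F | f.eval (x + α) - f.eval x = f.eval (α * u + α) - f.eval (α * u)} := by
      intro x hx
      simp only [Finset.coe_insert, Finset.coe_singleton, Set.mem_insert_iff,
        Set.mem_singleton_iff] at hx
      rcases hx with rfl | rfl | rfl
      · rfl
      · change f.eval (α * u + α + α) - _ = _
        rw [add_assoc, CharTwo.add_self_eq_zero, add_zero]
        linear_combination (f.eval (α * u) - f.eval (α * u + α)) * h2
      · change f.eval (α * v + α) - _ = _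
        linear_combination -h + (f.eval (α * u) - f.eval (α * v)) * h2
    have hcard : ({α * u, α * u + α, α * v} : Finset F).card = 3 := by
      rw [Finset.card_eq_three]
      refine ⟨_, _, _, ?_, ?_, ?_, rfl⟩
      · simpa using hα
      · simpa [hα] using huv
      · intro h'
        apply huv1
        apply mul_left_cancel₀ hα
        linear_combination h' - α * h2
    have := Set.ncard_le_ncard hsub (Set.toFinite _)
    rw [Set.ncard_coe_finset, hcard] at this
    exact this
  intro hf
  rw [IsAPN] at hf
  omega

lemma hasCollision_of_eval_diffPoly {F : Type*} [Field F] [CharP F 2] {k : ℕ} (hk : 0 < k)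
    {a₀ a₁ a₂ α u : F} (hα : α ≠ 0) (hu : u ≠ 0) (hu1 : u ≠ 1)
    (h : a₀ * α ^ 2 * (diffPoly F (k + 1)).eval u ^ 2 + a₁ * α * (diffPoly F (2 * k + 1)).eval u +
      a₂ * (diffPoly F k).eval u ^ 2 = 0) :
    HasCollision fun x => a₀ * x ^ (2 * k + 2) + a₁ * x ^ (2 * k + 1) + a₂ * x ^ (2 * k) := by
  refine ⟨α, u, 0, hα, hu, by simpa using hu1, ?_⟩
  have h2 : (2 : F) = 0 := CharTwo.two_eq_zero
  rw [eval_diffPoly, eval_diffPoly, eval_diffPoly, CharTwo.add_sq, CharTwo.add_sq, CharTwo.add_sq,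
    CharTwo.add_sq] at h
  have h0 : (0 : F) ^ (2 * k) = 0 := zero_pow (by omega)
  have hau : α * u + α = α * (u + 1) := by ring
  simp only [mul_zero, zero_add, hau, mul_pow, pow_succ (0 : F), h0]
  linear_combination α ^ (2 * k) * h -
    α ^ (2 * k) * (a₀ * α ^ 2 + a₁ * α + a₂) * h2

lemma hasCollision_of_sq_add_self_eq {F : Type*} [Field F] [CharP F 2] {k : ℕ} (hk : 0 < k)
    {a₀ a₁ a₂ b u w : F} (h₀ : a₀ ≠ 0) (h₁ : a₁ ≠ 0) (hb : b ^ 2 * a₁ ^ 2 = a₀ * a₂)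
    (hu : u ≠ 0) (hu1 : u ≠ 1) (hG : (diffPoly F (2 * k + 1)).eval u ≠ 0)
    (hP : (diffPoly F (k + 1)).eval u ≠ 0)
    (hw : w ^ 2 + w =
      b * (diffPoly F (k + 1)).eval u * (diffPoly F k).eval u / (diffPoly F (2 * k + 1)).eval u) :
    HasCollision fun x => a₀ * x ^ (2 * k + 2) + a₁ * x ^ (2 * k + 1) + a₂ * x ^ (2 * k) := by
  have h2 : (2 : F) = 0 := CharTwo.two_eq_zero
  wlog hw0 : w ≠ 0 generalizing w
  · rw [not_not] at hw0
    refine this (w := 1) ?_ one_ne_zero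
    rw [← hw, hw0]
    linear_combination h2
  rw [eq_div_iff hG] at hw
  set G := (diffPoly F (2 * k + 1)).eval u with hGdef
  set P := (diffPoly F (k + 1)).eval u with hPdef
  set R := (diffPoly F k).eval u with hRdef
  have haP : a₀ * P ^ 2 ≠ 0 := mul_ne_zero h₀ (pow_ne_zero 2 hP)
  obtain ⟨α, hα⟩ : ∃ α, α * (a₀ * P ^ 2) = w ^ 2 * a₁ * G :=
    ⟨w ^ 2 * a₁ * G / (a₀ * P ^ 2), div_mul_cancel₀ _ haP⟩
  have hα0 : α ≠ 0 := by
    rintro rfl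
    rw [zero_mul] at hα
    exact mul_ne_zero (mul_ne_zero (pow_ne_zero 2 hw0) h₁) hG hα.symm
  refine hasCollision_of_eval_diffPoly hk hα0 hu hu1 ?_
  rw [← hGdef, ← hPdef, ← hRdef]
  apply mul_left_cancel₀ haP
  linear_combination (α * (a₀ * P ^ 2) + w ^ 2 * a₁ * G + a₁ * G) * hα - P ^ 2 * R ^ 2 * hb
    - a₁ ^ 2 * (b * P * R + (w ^ 2 + w) * G) * hw
    + a₁ ^ 2 * G ^ 2 * (w ^ 4 + w ^ 3 + w ^ 2) * h2

lemma eval_map_diffPoly {F K : Type*} [Field F] [Field K] (φ : F →+* K) (j : ℕ) (u : F) :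
    (diffPoly K j).eval (φ u) = φ ((diffPoly F j).eval u) := by
  simp [eval_diffPoly]

lemma diffPoly_ne_zero_of_eval {F K : Type*} [Field F] [Field K] (φ : F →+* K) {j : ℕ} {θ : K}
    (h : (diffPoly K j).eval θ ≠ 0) : diffPoly F j ≠ 0 := by
  intro h0
  apply h
  have : diffPoly K j = (diffPoly F j).map φ := by simp [diffPoly]
  rw [this, h0, Polynomial.map_zero, eval_zero]

lemma hasCollision_of_five_le {F : Type*} [Field F] [Fintype F] [CharP F 2] {n k : ℕ}
    (hF : Fintype.card F = 2 ^ n) (φ : F →+* AlgebraicClosure (ZMod 2)) (hk : Odd k) (hk5 : 5 ≤ k)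
    (hM : InM (2 * k + 1)) (hn : 4 * k + 22 ≤ n) {a₀ a₁ : F} (a₂ : F) (h₀ : a₀ ≠ 0)
    (h₁ : a₁ ≠ 0) :
    HasCollision fun x => a₀ * x ^ (2 * k + 2) + a₁ * x ^ (2 * k + 1) + a₂ * x ^ (2 * k) := by
  classical
  by_contra hcon
  have h2 : (2 : AlgebraicClosure (ZMod 2)) = 0 := CharTwo.two_eq_zero
  obtain ⟨θ, hGθ, hQθ, hRθ⟩ := exists_isRoot_diffPoly hk hk5 hM
  have hRθ' : (diffPoly (AlgebraicClosure (ZMod 2)) k).eval θ ≠ 0 := by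
    rw [eval_diffPoly]
    intro h
    exact hRθ (by linear_combination h - h2)
  have hPθ : (diffPoly (AlgebraicClosure (ZMod 2)) (k + 1)).eval θ ≠ 0 := by
    intro h
    have hθ : θ * (θ + 1) * (θ ^ k + (θ + 1) ^ k) ^ 2 = 0 := by
      have h' := congrArg (· ^ 2) h
      simp only [eval_diffPoly, CharTwo.add_sq] at h' hGθ ⊢
      linear_combination h' - hGθ + θ ^ (2 * k) * θ * h2
    rcases mul_eq_zero.mp hθ with h' | h'
    · rcases mul_eq_zero.mp h' with h0 | h0
      · apply hRθ
        rw [h0, zero_pow (by omega)]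
        simp
      · apply hRθ
        rw [h0, zero_pow (by omega), add_zero, show θ = 1 by linear_combination h0 - h2, one_pow]
    · exact hQθ (eq_zero_of_pow_eq_zero h')
  obtain ⟨b, hb⟩ : ∃ b : F, b ^ 2 = a₀ * a₂ / a₁ ^ 2 := by
    obtain ⟨b, hb⟩ := FiniteField.isSquare_of_char_two (ringChar.eq F 2) (a₀ * a₂ / a₁ ^ 2)
    exact ⟨b, by rw [hb, pow_two]⟩
  rw [eq_div_iff (pow_ne_zero 2 h₁)] at hb
  let p : F[X] := X * (X + 1) * diffPoly F (2 * k + 1) * diffPoly F (k + 1)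
  have hp : p ≠ 0 := by
    refine mul_ne_zero (mul_ne_zero (mul_ne_zero X_ne_zero ?_) ?_) ?_
    · exact (monic_X_add_C 1).ne_zero
    · exact diffPoly_ne_zero (by omega) ⟨k, rfl⟩
    · exact diffPoly_ne_zero_of_eval φ hPθ
  have hpdeg : p.natDegree ≤ 3 * k + 4 := by
    refine (natDegree_mul_le_of_le (natDegree_mul_le_of_le (natDegree_mul_le_of_le natDegree_X_le
      (natDegree_X_add_C (1 : F)).le) (natDegree_diffPoly_le _)) (natDegree_diffPoly_le _)).trans ?_
    omega
  let U : Finset F := Finset.univ.filter fun u => p.eval u ≠ 0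
  have hU : 2 ^ n ≤ U.card + (3 * k + 4) :=
    hF ▸ (card_le_card_filter_eval_ne_zero hp).trans (Nat.add_le_add_left hpdeg _)
  have hlarge : 256 * (4 * k + 14) ≤ 2 ^ n := by
    have h1 : n - 8 < 2 ^ (n - 8) := Nat.lt_two_pow_self
    have h3 : 2 ^ n = 2 ^ 8 * 2 ^ (n - 8) := by rw [← pow_add]; congr 1; omega
    omega
  have hUmem : ∀ u ∈ U, (diffPoly F (2 * k + 1)).eval u ≠ 0 ∧
      ∀ w : F, w ^ 2 + w ≠ b * (diffPoly F (k + 1)).eval u * (diffPoly F k).eval u /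
        (diffPoly F (2 * k + 1)).eval u := by
    intro u hu
    have hu' := (Finset.mem_filter.mp hu).2
    simp only [p, eval_mul, eval_add, eval_X, eval_one, mul_ne_zero_iff] at hu'
    obtain ⟨⟨⟨hu0, hu1⟩, hG⟩, hP⟩ := hu'
    refine ⟨hG, fun w hw =>
      hcon (hasCollision_of_sq_add_self_eq (by omega) h₀ h₁ hb hu0 ?_ hG hP hw)⟩
    rintro rfl
    exact hu1 (CharTwo.add_self_eq_zero _)
  have hb0 : b ≠ 0 := by
    rintro rfl
    obtain ⟨u, hu⟩ : U.Nonempty := by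
      rw [← Finset.card_pos]
      omega
    exact (hUmem u hu).2 0 (by simp)
  have hcard := card_filter_trace_eq_one_le (d := 2 * k + 1) hF φ (by omega)
    (N := C (φ b) * diffPoly _ (k + 1) * diffPoly _ k) (D := diffPoly _ (2 * k + 1))
    ((natDegree_mul_le_of_le (natDegree_mul_le_of_le (natDegree_C _).le (natDegree_diffPoly_le _))
      (natDegree_diffPoly_le _)).trans (by omega))
    (natDegree_diffPoly_le _) hGθ (by simpa [derivative_diffPoly] using hQθ)
    (by simpa using ⟨⟨hb0, hPθ⟩, hRθ'⟩) U fun u hu => by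
      obtain ⟨hG, hw⟩ := hUmem u hu
      refine ⟨by rwa [eval_map_diffPoly, _root_.map_ne_zero], ?_⟩
      have := (exists_sq_add_self_eq_or_trace_eq_one hF φ _).resolve_left (not_exists.mpr hw)
      simpa only [eval_mul, eval_C, eval_map_diffPoly, map_mul, map_div₀] using this
  omega

lemma hasCollision_octic_of_ne_zero {F : Type*} [Field F] [Fintype F] [CharP F 2]
    (hF : 16 ≤ Fintype.card F) {a₀ a₁ a₂ : F} (h₁ : a₁ ≠ 0) (h₂ : a₂ ≠ 0) :
    HasCollision fun x => a₀ * x ^ 8 + a₁ * x ^ 7 + a₂ * x ^ 6 := by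
  classical
  have h2 : (2 : F) = 0 := CharTwo.two_eq_zero
  let p : F[X] := X * (X + 1) * diffPoly F 7
  have hp : p ≠ 0 := mul_ne_zero (mul_ne_zero X_ne_zero (monic_X_add_C 1).ne_zero)
    (diffPoly_ne_zero (by omega) (by decide))
  have hpdeg : p.natDegree ≤ 9 := natDegree_mul_le_of_le (natDegree_mul_le_of_le natDegree_X_le
      (natDegree_X_add_C (1 : F)).le) (natDegree_diffPoly_le _)
  obtain ⟨u, hu⟩ : (Finset.univ.filter fun u => p.eval u ≠ 0).Nonempty := by
    rw [← Finset.card_pos]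
    have := card_le_card_filter_eval_ne_zero hp
    omega
  have hu' := (Finset.mem_filter.mp hu).2
  simp only [p, eval_mul, eval_add, eval_X, eval_one, mul_ne_zero_iff] at hu'
  obtain ⟨⟨hu0, hu1⟩, hG⟩ := hu'
  have hP : (diffPoly F (3 + 1)).eval u = 0 := by
    rw [eval_diffPoly]
    linear_combination (u ^ 4 + 2 * u ^ 3 + 3 * u ^ 2 + 2 * u + 1) * h2
  have hR : (diffPoly F 3).eval u = u * (u + 1) := by
    rw [eval_diffPoly]
    linear_combination (u ^ 3 + u ^ 2 + u + 1) * h2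
  have hR0 := mul_ne_zero hu0 hu1
  refine hasCollision_of_eval_diffPoly (k := 3) (by norm_num)
    (α := a₂ * (u * (u + 1)) ^ 2 / (a₁ * (diffPoly F 7).eval u))
    (div_ne_zero (mul_ne_zero h₂ (pow_ne_zero 2 hR0)) (mul_ne_zero h₁ hG)) hu0 ?_ ?_
  · rintro rfl
    exact hu1 (CharTwo.add_self_eq_zero _)
  · rw [hP, hR]
    norm_num only [mul_zero, zero_add]
    rw [mul_div_assoc', div_mul_eq_mul_div, mul_right_comm,
      mul_div_cancel_left₀ _ (mul_ne_zero h₁ hG)]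
    exact CharTwo.add_self_eq_zero _

lemma hasCollision_octic_of_sq_add_self_eq {F : Type*} [Field F] [CharP F 2] (a₀ a₁ : F)
    {u v w : F} (hw : w ^ 2 + w + 1 ≠ 0) (hu : u ^ 2 + u = (w ^ 2 + 1) / (w ^ 2 + w + 1))
    (hv : v ^ 2 + v = w ^ 2 / (w ^ 2 + w + 1)) :
    HasCollision fun x => a₀ * x ^ 8 + a₁ * x ^ 7 + 0 * x ^ 6 := by
  have h2 : (2 : F) = 0 := CharTwo.two_eq_zero
  rw [eq_div_iff hw] at hu hv
  have hne : u ^ 2 + u ≠ v ^ 2 + v := by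
    intro h
    rw [h, hv] at hu
    exact one_ne_zero (by linear_combination -hu : (1 : F) = 0)
  have key : (u ^ 2 + u) ^ 2 + (u ^ 2 + u) * (v ^ 2 + v) + (v ^ 2 + v) ^ 2 + 1 = 0 := by
    apply mul_left_cancel₀ (pow_ne_zero 2 hw)
    generalize u ^ 2 + u = y at *
    generalize v ^ 2 + v = z at *
    linear_combination (y * (w ^ 2 + w + 1) + w ^ 2 + 1 + z * (w ^ 2 + w + 1)) * hu +
      (w ^ 2 + 1 + z * (w ^ 2 + w + 1) + w ^ 2) * hv +
      (2 * w ^ 4 + w ^ 3 + 3 * w ^ 2 + w + 1) * h2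
  refine ⟨1, u, v, one_ne_zero, ?_, ?_, ?_⟩
  · rintro rfl
    exact hne rfl
  · rintro rfl
    apply hne
    linear_combination (v + 1) * h2
  · have hg : ∀ x : F, (a₀ * (1 * x + 1) ^ 8 + a₁ * (1 * x + 1) ^ 7 + 0 * (1 * x + 1) ^ 6) +
        (a₀ * (1 * x) ^ 8 + a₁ * (1 * x) ^ 7 + 0 * (1 * x) ^ 6) =
        a₀ + a₁ * ((x ^ 2 + x) ^ 3 + (x ^ 2 + x) + 1) := by
      intro x
      linear_combination (a₀ * (x ^ 8 + 4 * x ^ 7 + 14 * x ^ 6 + 28 * x ^ 5 + 35 * x ^ 4 +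
        28 * x ^ 3 + 14 * x ^ 2 + 4 * x) + a₁ * (x ^ 7 + 3 * x ^ 6 + 9 * x ^ 5 + 16 * x ^ 4 +
        17 * x ^ 3 + 10 * x ^ 2 + 3 * x)) * h2
    simp only [hg]
    generalize u ^ 2 + u = y at *
    generalize v ^ 2 + v = z at *
    linear_combination a₁ * (y - z) * key

lemma two_mul_card_le_of_forall {α : Type*} [DecidableEq α] (U : Finset α) (p q r : α → Prop)
    [DecidablePred p] [DecidablePred q] [DecidablePred r]
    (h : ∀ w ∈ U, (p w ∧ q w) ∨ (q w ∧ r w) ∨ (p w ∧ r w)) :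
    2 * U.card ≤ (U.filter p).card + (U.filter q).card + (U.filter r).card := by
  rw [Finset.card_filter, Finset.card_filter, Finset.card_filter, ← Finset.sum_add_distrib,
    ← Finset.sum_add_distrib, mul_comm, ← smul_eq_mul]
  refine Finset.card_nsmul_le_sum _ _ _ fun w hw => ?_
  rcases h w hw with ⟨h1, h2⟩ | ⟨h1, h2⟩ | ⟨h1, h2⟩ <;> simp only [h1, h2, if_true] <;> omega

lemma hasCollision_octic {F : Type*} [Field F] [Fintype F] [CharP F 2] {n : ℕ}
    (hF : Fintype.card F = 2 ^ n) (φ : F →+* AlgebraicClosure (ZMod 2)) (hn : 24 ≤ n) (a₀ a₁ : F) :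
    HasCollision fun x => a₀ * x ^ 8 + a₁ * x ^ 7 + 0 * x ^ 6 := by
  classical
  by_contra hcon
  have h2 : (2 : AlgebraicClosure (ZMod 2)) = 0 := CharTwo.two_eq_zero
  let S : F → Prop := fun z => ∃ x, x ^ 2 + x = z
  let d : F → F := fun w => w ^ 2 + w + 1
  let U : Finset F := Finset.univ.filter fun w => d w ≠ 0
  have hp : (X ^ 2 + X + 1 : F[X]).natDegree = 2 := by compute_degree!
  have hp0 : (X ^ 2 + X + 1 : F[X]) ≠ 0 := by
    intro h
    rw [h] at hp
    simp at hp
  have hU : 2 ^ n ≤ U.card + 2 := by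
    have := card_le_card_filter_eval_ne_zero hp0
    rw [hp, hF] at this
    simpa using this
  obtain ⟨θ, hθ⟩ : ∃ θ : AlgebraicClosure (ZMod 2), θ ^ 2 + θ + 1 = 0 := by
    obtain ⟨θ, hθ⟩ := IsAlgClosed.exists_root (X ^ 2 + X + 1 : (AlgebraicClosure (ZMod 2))[X]) (by
      have : (X ^ 2 + X + 1 : (AlgebraicClosure (ZMod 2))[X]).degree = 2 := by compute_degree!
      rw [this]; decide)
    exact ⟨θ, by simpa using hθ⟩
  have hθ0 : θ ≠ 0 := by
    rintro rfl
    simp at hθ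
  have hcard : ∀ (f : F → F) (N : (AlgebraicClosure (ZMod 2))[X]), N.natDegree ≤ 2 →
      N.eval θ ≠ 0 → (∀ u, N.eval (φ u) = φ (f u)) →
      32 * (U.filter fun w => ¬ S (f w / d w)).card ≤ 19 * 2 ^ n := by
    intro f N hN hNθ hNf
    have hDθ : (derivative (X ^ 2 + X + 1 : (AlgebraicClosure (ZMod 2))[X])).eval θ ≠ 0 := by
      simp [one_add_one_eq_two, h2]
    refine card_filter_trace_eq_one_le (d := 2) hF φ (by omega) (N := N) (D := X ^ 2 + X + 1) hN
      (by compute_degree) (θ := θ) (by simpa using hθ) hDθ hNθ _ fun u hu => ?_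
    obtain ⟨huU, hS⟩ := Finset.mem_filter.mp hu
    have hDu : (X ^ 2 + X + 1 : (AlgebraicClosure (ZMod 2))[X]).eval (φ u) = φ (d u) := by
      simp [d]
    rw [hDu, hNf, ← map_div₀]
    exact ⟨(_root_.map_ne_zero φ).mpr (Finset.mem_filter.mp huU).2,
      (exists_sq_add_self_eq_or_trace_eq_one hF φ _).resolve_left hS⟩
  have hy := hcard (fun w => w ^ 2 + 1) (X ^ 2 + 1) (by compute_degree)
    (by simpa using fun h => hθ0 (by linear_combination hθ - h)) (by simp)
  have hz := hcard (fun w => w ^ 2) (X ^ 2) (by compute_degree) (by simpa using hθ0) (by simp)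
  have ht := hcard (fun _ => 1) 1 (by simp) (by simp) (by simp)
  have hSadd : ∀ x y, S x → S y → S (x + y) := by
    rintro _ _ ⟨a, rfl⟩ ⟨b, rfl⟩
    exact ⟨a + b, by rw [CharTwo.add_sq]; ring⟩
  have hsum := two_mul_card_le_of_forall U _ _ _ (fun w hw => by
    have hd := (Finset.mem_filter.mp hw).2
    have hyz : ¬ (S ((w ^ 2 + 1) / d w) ∧ S (w ^ 2 / d w)) := by
      rintro ⟨⟨u, hu⟩, ⟨v, hv⟩⟩
      exact hcon (hasCollision_octic_of_sq_add_self_eq a₀ a₁ hd hu hv)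
    have h3 : (w ^ 2 + 1) / d w = w ^ 2 / d w + 1 / d w := add_div _ _ _
    have h4 : w ^ 2 / d w = (w ^ 2 + 1) / d w + 1 / d w := by
      rw [h3, add_assoc, CharTwo.add_self_eq_zero, add_zero]
    have h5 := hSadd (w ^ 2 / d w) (1 / d w)
    have h6 := hSadd ((w ^ 2 + 1) / d w) (1 / d w)
    rw [← h3] at h5
    rw [← h4] at h6
    show (¬ S ((w ^ 2 + 1) / d w) ∧ ¬ S (w ^ 2 / d w)) ∨ (¬ S (w ^ 2 / d w) ∧ ¬ S (1 / d w)) ∨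
      (¬ S ((w ^ 2 + 1) / d w) ∧ ¬ S (1 / d w))
    by_cases hSy : S ((w ^ 2 + 1) / d w)
    · have hSz := fun hz => hyz ⟨hSy, hz⟩
      exact Or.inr (Or.inl ⟨hSz, fun ht => hSz (h6 hSy ht)⟩)
    · by_cases hSz : S (w ^ 2 / d w)
      · exact Or.inr (Or.inr ⟨hSy, fun ht => hSy (h5 hSz ht)⟩)
      · exact Or.inl ⟨hSy, hSz⟩)
  have hlarge : 2 ^ 6 ≤ 2 ^ n := Nat.pow_le_pow_right (by norm_num) (by omega)
  generalize 2 ^ n = q at *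
  omega

lemma trinomial_not_isAPN {F : Type*} [Field F] [Finite F] [CharP F 2] {m n : ℕ} (hm : 8 ≤ m)
    (hm4 : m % 4 = 0) (hM : InM (m - 1)) (hF : Nat.card F = 2 ^ n)
    (φ : F →+* AlgebraicClosure (ZMod 2)) (hn : 2 * m + 18 ≤ n) {a₀ a₁ : F} (a₂ : F) (h₀ : a₀ ≠ 0)
    (h₁ : a₁ ≠ 0) : ¬ IsAPN (C a₀ * X ^ m + C a₁ * X ^ (m - 1) + C a₂ * X ^ (m - 2)) := by
  have := Fintype.ofFinite F
  rw [Nat.card_eq_fintype_card] at hF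
  apply not_isAPN_of_hasCollision
  simp only [eval_add, eval_mul, eval_C, eval_pow, eval_X]
  obtain ⟨k, hk, hk3, rfl⟩ : ∃ k, Odd k ∧ 3 ≤ k ∧ m = 2 * k + 2 :=
    ⟨m / 2 - 1, Nat.odd_iff.mpr (by omega), by omega, by omega⟩
  rw [show 2 * k + 2 - 1 = 2 * k + 1 by omega] at hM ⊢
  rw [Nat.add_sub_cancel]
  rcases hk3.eq_or_lt with rfl | hk3
  · by_cases h₂ : a₂ = 0
    · rw [h₂]
      exact hasCollision_octic hF φ (by omega) a₀ a₁
    · refine hasCollision_octic_of_ne_zero ?_ h₁ h₂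
      rw [hF, show 16 = 2 ^ 4 by norm_num]
      exact Nat.pow_le_pow_right (by norm_num) (by omega)
  · have hk5 : 5 ≤ k := by
      obtain ⟨l, rfl⟩ := hk
      omega
    exact hasCollision_of_five_le hF φ hk hk5 hM (by omega) a₂ h₀ h₁

/-- Let `m ≥ 8` with `m ≡ 0 (mod 4)` and `m - 1 ∈ 𝓜`.  Then for `n` sufficiently large
(depending only on `m`), no trinomial `a₀ x^m + a₁ x^(m-1) + a₂ x^(m-2)` over `𝔽_{2^n}` of
degree `m` with `a₁ ≠ 0` is APN over `𝔽_{2^n}`; in particular no such polynomial is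
exceptional APN. -/
theorem trinomial_not_APN_not_exceptionalAPN (m : ℕ) (hm : 8 ≤ m) (hm4 : m % 4 = 0)
    (hM : InM (m - 1)) :
    ∃ N : ℕ, ∀ n : ℕ, N ≤ n → ∀ a₀ a₁ a₂ : GaloisField 2 n, a₀ ≠ 0 → a₁ ≠ 0 →
      ¬ IsAPN (C a₀ * X ^ m + C a₁ * X ^ (m - 1) + C a₂ * X ^ (m - 2)) ∧
      ¬ IsExceptionalAPN n (C a₀ * X ^ m + C a₁ * X ^ (m - 1) + C a₂ * X ^ (m - 2)) := by
  have key : ∀ n, 2 * m + 18 ≤ n → ∀ a₀ a₁ a₂ : GaloisField 2 n, a₀ ≠ 0 → a₁ ≠ 0 →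
      ¬ IsAPN (C a₀ * X ^ m + C a₁ * X ^ (m - 1) + C a₂ * X ^ (m - 2)) :=
    fun n hn a₀ a₁ a₂ h₀ h₁ =>
      trinomial_not_isAPN hm hm4 hM (GaloisField.card 2 n (by omega))
        (IsAlgClosed.lift : GaloisField 2 n →ₐ[ZMod 2] AlgebraicClosure (ZMod 2)).toRingHom
        hn a₂ h₀ h₁
  refine ⟨2 * m + 18, fun n hn a₀ a₁ a₂ h₀ h₁ => ⟨key n hn a₀ a₁ a₂ h₀ h₁, fun h => ?_⟩⟩
  obtain ⟨k, ⟨φ, hφ⟩, hk⟩ := Set.Infinite.exists_gt h (2 * m + 18)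
  refine key k hk.le (φ a₀) (φ a₁) (φ a₂) ((_root_.map_ne_zero φ).mpr h₀)
    ((_root_.map_ne_zero φ).mpr h₁) ?_
  simpa using hφ
end

section
/- Let m ≥ 8 be an integer such that m ≡ 0 (mod 4) and m−1 ∈ 𝓜, and set d = (m−2)/2. For every binomial f(x) = a₀x^m + a₁x^{m−1} ∈ 𝔽_{2ⁿ}[x] with a₁ ≠ 0, the number of α ∈ 𝔽_{2ⁿ}\{0} for which the polynomial L_α f fails to have distinct critical values is at most (6d+4)·C((d−1)/2, 2), where C(·,·) denotes the binomial coefficient. -/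
open Polynomial

/-- A polynomial `g` over a field `F` has distinct critical values if for any `τ, η` in the
algebraic closure of `F`, `g'(τ) = g'(η) = 0` and `g(τ) = g(η)` imply `τ = η`. -/
def HasDistinctCriticalValues {F : Type*} [Field F] (g : F[X]) : Prop :=
  ∀ τ η : AlgebraicClosure F,
    aeval τ (derivative g) = 0 → aeval η (derivative g) = 0 →
    aeval τ g = aeval η g → τ = η

section CriticalPoints

variable {F K : Type*} [Field F] [CharP F 2] [Field K] [IsAlgClosed K] [Algebra F K]

/-- Every critical point of `L_α f`, `f = a₀ x^(k+2) + a₁ x^(k+1)` with `k` even, is of the form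
`α² ζ / (1 + ζ)²` for a nontrivial `k`-th root of unity `ζ`, with critical value
`α^(k+1) (a₀ α + a₁) / (1 + ζ)^k`. -/
theorem exists_rootOfUnity_of_isCritical {k : ℕ} (hk : Even k) (hk0 : k ≠ 0)
    {a₀ a₁ α : F} (ha₁ : a₁ ≠ 0) (hα : α ≠ 0) {L : F[X]}
    (hL : L.comp (X * (X + C α)) =
      (C a₀ * X ^ (k + 2) + C a₁ * X ^ (k + 1)).comp (X + C α) -
        (C a₀ * X ^ (k + 2) + C a₁ * X ^ (k + 1)))
    {τ : K} (hτ : aeval τ (derivative L) = 0) :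
    ∃ ζ : K, ζ ≠ 1 ∧ ζ ^ k = 1 ∧ τ * (1 + ζ) ^ 2 = algebraMap F K α ^ 2 * ζ ∧
      aeval τ L * (1 + ζ) ^ k =
        algebraMap F K α ^ (k + 1) * algebraMap F K (a₀ * α + a₁) := by
  have : CharP K 2 := charP_of_injective_algebraMap (algebraMap F K).injective 2
  have h2 : (2 : K) = 0 := CharTwo.two_eq_zero
  have hkK : (k : K) = 0 := (CharP.cast_eq_zero_iff K 2 k).2 hk.two_dvd
  set a := algebraMap F K α with ha
  have ha0 : a ≠ 0 := by simpa [ha] using hα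
  have hb0 : algebraMap F K a₁ ≠ 0 := by simpa using ha₁
  obtain ⟨x, hx⟩ : ∃ x : K, x * (x + a) = τ := by
    obtain ⟨x, hx⟩ := IsAlgClosed.exists_root (X ^ 2 + C a * X - C τ : K[X])
      (by
        have : (X ^ 2 + C a * X - C τ : K[X]).natDegree = 2 := by compute_degree!
        intro h
        have h0 := natDegree_eq_of_degree_eq_some h
        simp_all)
    refine ⟨x, ?_⟩
    simp only [IsRoot.def, eval_sub, eval_add, eval_mul, eval_pow, eval_X, eval_C] at hx
    linear_combination hx
  have hval := congrArg (aeval x) hL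
  have hder := congrArg (fun p => aeval x (derivative p)) hL
  simp only [aeval_comp, map_mul, map_add, map_sub, map_pow, aeval_X, aeval_C, ← ha, hx] at hval
  simp only [derivative_comp, derivative_mul, derivative_X_pow,
    derivative_C, derivative_X, aeval_comp, map_mul, map_add, map_sub, map_pow, aeval_X, aeval_C,
    ← ha, hx, hτ] at hder
  push_cast at hder
  simp only [hkK, h2, map_zero, map_one, map_ofNat, mul_zero, zero_mul, zero_add, add_zero,
    mul_one, one_mul] at hder
  have hpow : (x + a) ^ k = x ^ k := by
    have : algebraMap F K a₁ * ((x + a) ^ k - x ^ k) = 0 := by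
      linear_combination -hder
    exact sub_eq_zero.1 ((mul_eq_zero.1 this).resolve_left hb0)
  have hx0 : x ≠ 0 := by
    rintro rfl
    rw [zero_add, zero_pow hk0] at hpow
    exact ha0 (pow_eq_zero_iff hk0 |>.1 hpow)
  have hζ : x * (1 + (x + a) / x) = a := by
    field_simp
    linear_combination x * h2
  refine ⟨(x + a) / x, ?_, ?_, ?_, ?_⟩
  · rw [Ne, div_eq_one_iff_eq hx0]
    simpa using ha0
  · rw [div_pow, hpow, div_self (pow_ne_zero _ hx0)]
  · have h1 : x * ((x + a) / x) = x + a := by field_simp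
    rw [← hx]
    calc x * (x + a) * (1 + (x + a) / x) ^ 2
        = (x * (1 + (x + a) / x)) ^ 2 * ((x + a) / x) := by rw [← h1]; field_simp
      _ = _ := by rw [hζ]
  · have hv : aeval τ L = x ^ k * (a * algebraMap F K (a₀ * α + a₁)) := by
      rw [hval, map_add, map_mul, ← ha]
      linear_combination (algebraMap F K a₀ * (x + a) ^ 2 + algebraMap F K a₁ * (x + a)) * hpow
        + algebraMap F K a₀ * x ^ k * x * a * h2
    have hak : x ^ k * (1 + (x + a) / x) ^ k = a ^ k := by rw [← mul_pow, hζ]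
    rw [hv, pow_succ]
    linear_combination a * algebraMap F K (a₀ * α + a₁) * hak

end CriticalPoints

/-- The defining property of `InM` transfers to algebraic extensions of `𝔽₂`. -/
theorem InM.eq_or_eq_inv {m : ℕ} (hM : InM m) {K : Type*} [Field K] [Algebra (ZMod 2) K]
    [Algebra.IsAlgebraic (ZMod 2) K] {ζ₁ ζ₂ : K} (h₁ : ζ₁ ≠ 1) (h₂ : ζ₂ ≠ 1)
    (hp₁ : ζ₁ ^ (m - 1) = 1) (hp₂ : ζ₂ ^ (m - 1) = 1)
    (hq : (1 + ζ₁) ^ (m - 1) = (1 + ζ₂) ^ (m - 1)) : ζ₁ = ζ₂ ∨ ζ₁ = ζ₂⁻¹ := by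
  let φ : K →ₐ[ZMod 2] AlgebraicClosure (ZMod 2) := IsAlgClosed.lift
  have hφ : Function.Injective φ := φ.toRingHom.injective
  have : CharP K 2 := charP_of_injective_algebraMap (algebraMap (ZMod 2) K).injective 2
  have hne : 1 + ζ₂ ≠ 0 := fun h => h₂ (CharTwo.add_eq_zero.1 h).symm
  have := hM.2.2 (φ ζ₁) (φ ζ₂) (by rwa [Ne, map_eq_one_iff φ hφ])
    (by rwa [Ne, map_eq_one_iff φ hφ]) (by rw [← map_pow, hp₁, map_one])
    (by rw [← map_pow, hp₂, map_one])
    (by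
      rw [← map_one φ, ← map_add, ← map_add, ← map_div₀, ← map_pow, div_pow, hq,
        div_self (pow_ne_zero _ hne)])
  rwa [← map_inv₀, hφ.eq_iff, hφ.eq_iff] at this

/-- Let `m ≥ 8` with `m ≡ 0 (mod 4)` and `m - 1 ∈ 𝓜`, and set `d = (m-2)/2`.  For every
binomial `f = a₀ x^m + a₁ x^(m-1)` over `𝔽_{2^n}` with `a₁ ≠ 0`, the number of
`α ∈ 𝔽_{2^n} \ {0}` for which `L_α f` (the polynomial with `L_α f (x(x+α)) = f(x+α) - f(x)`)
fails to have distinct critical values is at most `(6d+4) * C((d-1)/2, 2)`. -/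
theorem binomial_card_not_distinct_critical_values_le (n m d : ℕ) (hm : 8 ≤ m)
    (hm4 : m % 4 = 0) (hM : InM (m - 1)) (hd : d = (m - 2) / 2)
    (a₀ a₁ : GaloisField 2 n) (ha₁ : a₁ ≠ 0) :
    {α : GaloisField 2 n | α ≠ 0 ∧ ∃ L : Polynomial (GaloisField 2 n),
        L.comp (X * (X + C α)) =
          (C a₀ * X ^ m + C a₁ * X ^ (m - 1)).comp (X + C α) -
            (C a₀ * X ^ m + C a₁ * X ^ (m - 1)) ∧
        ¬ HasDistinctCriticalValues L}.ncard
      ≤ (6 * d + 4) * Nat.choose ((d - 1) / 2) 2 := by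
  have : Fact (Nat.Prime 2) := ⟨Nat.prime_two⟩
  obtain ⟨j, rfl⟩ : ∃ j, m = 4 * j + 6 + 2 := ⟨m / 4 - 2, by omega⟩
  have hk : Even (4 * j + 6) := ⟨2 * j + 3, by ring⟩
  have : Algebra.IsAlgebraic (ZMod 2) (AlgebraicClosure (GaloisField 2 n)) :=
    Algebra.IsAlgebraic.trans (ZMod 2) (GaloisField 2 n) (AlgebraicClosure (GaloisField 2 n))
  have : CharP (AlgebraicClosure (GaloisField 2 n)) 2 :=
    charP_of_injective_algebraMap (algebraMap (GaloisField 2 n) _).injective 2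
  have hcancel : ∀ ζ : AlgebraicClosure (GaloisField 2 n), ζ ≠ 1 → 1 + ζ ≠ 0 :=
    fun ζ h h' => h (CharTwo.add_eq_zero.1 h').symm
  have key : ∀ α : GaloisField 2 n, α ≠ 0 → (∃ L : Polynomial (GaloisField 2 n),
      L.comp (X * (X + C α)) =
        (C a₀ * X ^ (4 * j + 6 + 2) + C a₁ * X ^ (4 * j + 6 + 1)).comp (X + C α) -
          (C a₀ * X ^ (4 * j + 6 + 2) + C a₁ * X ^ (4 * j + 6 + 1)) ∧
      ¬ HasDistinctCriticalValues L) → j ≠ 0 ∧ a₀ * α + a₁ = 0 := by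
    rintro α hα ⟨L, hL, hdist⟩
    by_contra hcon
    refine hdist fun τ η hτ hη hτη => ?_
    obtain ⟨ζ₁, h₁, hp₁, ht₁, hv₁⟩ :=
      exists_rootOfUnity_of_isCritical hk (by omega) ha₁ hα hL hτ
    obtain ⟨ζ₂, h₂, hp₂, ht₂, hv₂⟩ :=
      exists_rootOfUnity_of_isCritical hk (by omega) ha₁ hα hL hη
    have hn₁ := hcancel ζ₁ h₁
    have hn₂ := hcancel ζ₂ h₂
    by_cases hj : j = 0
    · subst hj
      have two : (2 : AlgebraicClosure (GaloisField 2 n)) = 0 := CharTwo.two_eq_zero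
      have aux : ∀ σ ζ : AlgebraicClosure (GaloisField 2 n), ζ ≠ 1 → ζ ^ (4 * 0 + 6) = 1 →
          σ * (1 + ζ) ^ 2 = algebraMap _ _ α ^ 2 * ζ → σ = algebraMap _ _ α ^ 2 := by
        intro σ ζ h hp ht
        have hz : ζ ≠ 0 := by
          rintro rfl
          simp at hp
        have hq : ζ ^ 2 + ζ + 1 = 0 := by
          have : ((1 + ζ) * (ζ ^ 2 + ζ + 1)) ^ 2 = 0 := by
            linear_combination hp + (1 + 2 * ζ + 4 * ζ ^ 2 + 5 * ζ ^ 3 + 4 * ζ ^ 4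
              + 2 * ζ ^ 5) * two
          exact (mul_eq_zero.1 (pow_eq_zero_iff two_ne_zero |>.1 this)).resolve_left (hcancel ζ h)
        refine mul_right_cancel₀ hz ?_
        linear_combination ht - σ * hq
      rw [aux τ ζ₁ h₁ hp₁ ht₁, aux η ζ₂ h₂ hp₂ ht₂]
    · have hc : a₀ * α + a₁ ≠ 0 := fun h => hcon ⟨hj, h⟩
      have hval : aeval η L ≠ 0 := by
        intro h
        rw [h, zero_mul] at hv₂
        exact mul_ne_zero (pow_ne_zero _ (by simpa using hα)) ((_root_.map_ne_zero _).2 hc) hv₂.symm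
      have hq : (1 + ζ₁) ^ (4 * j + 6) = (1 + ζ₂) ^ (4 * j + 6) :=
        mul_left_cancel₀ hval (by rw [← hτη, hv₁, hτη, hv₂])
      rcases hM.eq_or_eq_inv h₁ h₂ hp₁ hp₂ hq with rfl | rfl
      · exact mul_right_cancel₀ (pow_ne_zero 2 hn₁) (ht₁.trans ht₂.symm)
      · have hz : ζ₂ ≠ 0 := by
          rintro rfl
          simp at hp₂
        refine mul_right_cancel₀ (pow_ne_zero 2 hn₂) (Eq.trans ?_ ht₂.symm)
        field_simp at ht₁
        linear_combination ht₁
  by_cases hj : j = 0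
  · refine le_of_eq_of_le ?_ (Nat.zero_le _)
    rw [Set.ncard_eq_zero]
    exact Set.eq_empty_of_forall_notMem fun α hα => (key α hα.1 hα.2).1 hj
  · refine le_trans ((Set.ncard_le_one_iff (Set.toFinite _)).2 fun {α β} hα hβ => ?_) ?_
    · have eα := (key α hα.1 hα.2).2
      have eβ := (key β hβ.1 hβ.2).2
      have ha₀ : a₀ ≠ 0 := by
        rintro rfl
        simp [ha₁] at eα
      exact mul_left_cancel₀ ha₀ (by linear_combination eα - eβ)
    · have : 0 < Nat.choose ((d - 1) / 2) 2 := Nat.choose_pos (by omega)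
      nlinarith
end

section
/- Let m ≥ 8 be an integer with m ≡ 0 (mod 4), and let a₀, a₁, a₂ ∈ 𝔽_{2ⁿ} with a₀ ≠ 0 and a₁ ≠ 0. Consider f(x) = a₀x^m + a₁x^{m−1} + a₂x^{m−2} and h(x) = a₀x^m + a₁x^{m−1}. Then for every α ∈ 𝔽_{2ⁿ}\{0}, the polynomial L_α f has distinct critical values if and only if L_α h has distinct critical values. -/
open Polynomial

/-- Adding a multiple of the derivative does not change the values at critical points. -/
theorem hasDistinctCriticalValues_congr {F : Type*} [Field F] {p q : F[X]} (c : F)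
    (hd : derivative p = derivative q) (h : p = q + C c * derivative q) :
    HasDistinctCriticalValues p ↔ HasDistinctCriticalValues q := by
  have key (τ : AlgebraicClosure F) (hτ : aeval τ (derivative q) = 0) :
      aeval τ p = aeval τ q := by
    rw [h]
    simp [hτ]
  unfold HasDistinctCriticalValues
  rw [hd]
  refine forall₄_congr fun τ η hτ hη => ?_
  rw [key τ hτ, key η hη]

theorem comp_X_mul_X_add_C_injective {F : Type*} [Field F] (α : F) :
    Function.Injective fun p : F[X] => p.comp (X * (X + C α)) := by
  intro p q hpq
  have h : (p - q).comp (X * (X + C α)) = 0 := by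
    simpa [sub_comp, sub_eq_zero] using hpq
  rcases comp_eq_zero_iff.1 h with h | ⟨-, h⟩
  · exact sub_eq_zero.1 h
  · have hdeg := congrArg natDegree h
    rw [natDegree_C, natDegree_mul X_ne_zero (X_add_C_ne_zero α), natDegree_X,
      natDegree_X_add_C] at hdeg
    omega

/-- In characteristic two, if `L (x (x + α)) = f (x + α) - f x`, then
`α L' (x (x + α)) = f' (x + α) - f' x`. -/
theorem C_mul_derivative_comp_of_comp_eq {F : Type*} [Field F] [CharP F 2] {α : F} {L f : F[X]}
    (hL : L.comp (X * (X + C α)) = f.comp (X + C α) - f) :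
    (C α * derivative L).comp (X * (X + C α)) =
      (derivative f).comp (X + C α) - derivative f := by
  have h := congrArg derivative hL
  have hX : (X : F[X]) + X = 0 := CharTwo.add_self_eq_zero X
  have hq : derivative (X * (X + C α) : F[X]) = C α := by
    simp only [derivative_mul, derivative_X, derivative_add, derivative_C]
    linear_combination hX
  rw [derivative_comp, hq, derivative_sub, derivative_comp] at h
  simpa using h

/-- Let `m ≥ 8` with `m ≡ 0 (mod 4)`, and let `a₀, a₁, a₂ ∈ 𝔽_{2^n}` with `a₀ ≠ 0` and
`a₁ ≠ 0`.  For `f = a₀ x^m + a₁ x^(m-1) + a₂ x^(m-2)` and `h = a₀ x^m + a₁ x^(m-1)` and any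
`α ≠ 0`, the polynomial `L_α f` (characterized by `L_α f (x(x+α)) = f(x+α) - f(x)`) has
distinct critical values if and only if `L_α h` has distinct critical values. -/
theorem trinomial_distinct_critical_values_iff_binomial (n m : ℕ) (hm : 8 ≤ m)
    (hm4 : m % 4 = 0) (a₀ a₁ a₂ : GaloisField 2 n) (ha₀ : a₀ ≠ 0) (ha₁ : a₁ ≠ 0)
    (α : GaloisField 2 n) (hα : α ≠ 0)
    (Lf Lh : Polynomial (GaloisField 2 n))
    (hLf : Lf.comp (X * (X + C α)) =
      (C a₀ * X ^ m + C a₁ * X ^ (m - 1) + C a₂ * X ^ (m - 2)).comp (X + C α) -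
        (C a₀ * X ^ m + C a₁ * X ^ (m - 1) + C a₂ * X ^ (m - 2)))
    (hLh : Lh.comp (X * (X + C α)) =
      (C a₀ * X ^ m + C a₁ * X ^ (m - 1)).comp (X + C α) -
        (C a₀ * X ^ m + C a₁ * X ^ (m - 1))) :
    HasDistinctCriticalValues Lf ↔ HasDistinctCriticalValues Lh := by
  have h2 : (2 : GaloisField 2 n) = 0 := CharTwo.two_eq_zero
  obtain ⟨k, rfl⟩ : ∃ k, m = 2 * k + 2 := ⟨(m - 2) / 2, by omega⟩
  have e1 : 2 * k + 2 - 1 = 2 * k + 1 := rfl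
  have e2 : 2 * k + 2 - 2 = 2 * k := rfl
  rw [e1, e2] at hLf
  rw [e1] at hLh
  have dh : derivative (C a₀ * X ^ (2 * k + 2) + C a₁ * X ^ (2 * k + 1)) =
      C a₁ * X ^ (2 * k) := by
    simp [h2, one_add_one_eq_two]
  have df : derivative (C a₀ * X ^ (2 * k + 2) + C a₁ * X ^ (2 * k + 1) + C a₂ * X ^ (2 * k)) =
      C a₁ * X ^ (2 * k) := by
    rw [derivative_add, dh]
    simp [derivative_X_pow, h2]
  have hf' := C_mul_derivative_comp_of_comp_eq hLf
  have hh' := C_mul_derivative_comp_of_comp_eq hLh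
  rw [df] at hf'
  rw [dh] at hh'
  refine hasDistinctCriticalValues_congr (a₂ * α / a₁) ?_ ?_
  · exact mul_left_cancel₀ (C_ne_zero.2 hα)
      (comp_X_mul_X_add_C_injective α (hf'.trans hh'.symm))
  · apply mul_left_cancel₀ (C_ne_zero.2 ha₁)
    apply comp_X_mul_X_add_C_injective α
    have hc : C a₁ * (Lh + C (a₂ * α / a₁) * derivative Lh) =
        C a₁ * Lh + C a₂ * (C α * derivative Lh) := by
      rw [mul_add, ← mul_assoc, ← C_mul, mul_div_cancel₀ _ ha₁, C_mul, mul_assoc]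
    simp only [hc]
    rw [add_comp, mul_comp (C a₂), hh', mul_comp, mul_comp, hLf, hLh]
    simp only [add_comp, mul_comp, C_comp, X_pow_comp]
    ring
end

section
/- Let m be an odd positive integer. Then m ∈ 𝓜 if and only if 2(m−1)+1 ∈ 𝓜. -/
/-- For an odd positive integer `m`, `m ∈ 𝓜` if and only if `2(m-1)+1 ∈ 𝓜`. -/
theorem mem_M_iff_two_mul_sub_one_add_one_mem_M (m : ℕ) (hodd : Odd m) (hpos : 0 < m) :
    InM m ↔ InM (2 * (m - 1) + 1) := by
  have pow_two_mul_eq_one_iff (x : AlgebraicClosure (ZMod 2)) :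
      x ^ (2 * (m - 1)) = 1 ↔ x ^ (m - 1) = 1 := by
    have : CharP (AlgebraicClosure (ZMod 2)) 2 :=
      charP_of_injective_algebraMap (algebraMap (ZMod 2) _).injective 2
    rw [mul_comm, pow_mul, ← frobenius_def]
    exact (frobenius_inj (AlgebraicClosure (ZMod 2)) 2).eq_iff' (map_one _)
  have hodd' : Odd (2 * (m - 1) + 1) := ⟨m - 1, rfl⟩
  simp only [InM, hodd, hpos, hodd', hodd'.pos, Nat.add_sub_cancel, pow_two_mul_eq_one_iff]
end

section
/- Let m be an odd positive integer and k a nonnegative integer. Then m ∈ 𝓜 if and only if 2^k(m−1)+1 ∈ 𝓜. -/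
/-- In a reduced commutative ring of characteristic two, `2`-power multiples in the exponent do not
create new roots of unity. -/
lemma pow_two_pow_mul_eq_one_iff {R : Type*} [CommRing R] [IsReduced R] [CharP R 2]
    (k n : ℕ) (x : R) : x ^ (2 ^ k * n) = 1 ↔ x ^ n = 1 := by
  rw [mul_comm, pow_mul]
  have : Fact (Nat.Prime 2) := ⟨Nat.prime_two⟩
  exact ⟨fun h => iterateFrobenius_inj R 2 k (by simpa [iterateFrobenius_def] using h),
    fun h => by rw [h, one_pow]⟩

/-- For an odd positive integer `m` and a nonnegative integer `k`,
`m ∈ 𝓜` if and only if `2 ^ k * (m-1) + 1 ∈ 𝓜`. -/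
theorem mem_M_iff_pow_two_mul_sub_one_add_one_mem_M (m k : ℕ) (hodd : Odd m) (hpos : 0 < m) :
    InM m ↔ InM (2 ^ k * (m - 1) + 1) := by
  have hodd' : Odd (2 ^ k * (m - 1) + 1) := (hodd.tsub_odd odd_one).mul_left _ |>.add_one
  have : CharP (AlgebraicClosure (ZMod 2)) 2 := charP_of_injective_algebraMap'
    (ZMod 2) 2
  simp only [InM, hodd, hpos, hodd', Nat.succ_pos, true_and, Nat.add_sub_cancel,
    pow_two_pow_mul_eq_one_iff]
end

section
/- Let m be an even positive integer such that for all ζ₁, ζ₂ in the algebraic closure of 𝔽₂ with ζ₁ ≠ 1 and ζ₂ ≠ 1, the conditions ζ₁^{m−1} = ζ₂^{m−1} = ((1+ζ₁)/(1+ζ₂))^{m−1} = 1 imply ζ₁ = ζ₂ or ζ₁ = ζ₂^{−1}. Then for every integer k ≥ 1, the integer 2^k(m−1)+1 belongs to 𝓜. -/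
/-- If an even positive integer `m` satisfies the root-of-unity condition defining `𝓜`, then
`2 ^ k * (m-1) + 1 ∈ 𝓜` for every `k ≥ 1`. -/
theorem pow_two_mul_mem_M_of_even (m : ℕ) (heven : Even m) (hpos : 0 < m)
    (hcond : ∀ ζ₁ ζ₂ : AlgebraicClosure (ZMod 2), ζ₁ ≠ 1 → ζ₂ ≠ 1 →
      ζ₁ ^ (m - 1) = 1 → ζ₂ ^ (m - 1) = 1 →
      ((1 + ζ₁) / (1 + ζ₂)) ^ (m - 1) = 1 →
      ζ₁ = ζ₂ ∨ ζ₁ = ζ₂⁻¹) :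
    ∀ k : ℕ, 1 ≤ k → InM (2 ^ k * (m - 1) + 1) := by
  intro k hk
  have key (x : AlgebraicClosure (ZMod 2)) (hx : x ^ (2 ^ k * (m - 1) + 1 - 1) = 1) :
      x ^ (m - 1) = 1 := by
    have : ExpChar (AlgebraicClosure (ZMod 2)) 2 := .prime Nat.prime_two
    rwa [Nat.add_sub_cancel, ExpChar.pow_prime_pow_mul_eq_one_iff 2] at hx
  refine ⟨?_, Nat.succ_pos _, fun ζ₁ ζ₂ h₁ h₂ e₁ e₂ e₃ ↦
    hcond ζ₁ ζ₂ h₁ h₂ (key _ e₁) (key _ e₂) (key _ e₃)⟩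
  exact ((even_two.pow_of_ne_zero (by omega)).mul_right _).add_one
end

section
/- Let f ∈ 𝔽_{2ⁿ}[x] be a polynomial of degree m ≥ 7 and let α ∈ 𝔽_{2ⁿ}\{0}. Then L_α f has distinct critical values if and only if the following holds: for all τ, η in the algebraic closure of 𝔽_{2ⁿ}, if (D_α f)'(τ) = (D_α f)'(η) = 0 and D_α f(τ) = D_α f(η), then τ = η or τ = η + α. -/
open Polynomial

theorem aeval_comp_X_mul_X_add_C {F K : Type*} [Field F] [Field K] [Algebra F K]
    (g : F[X]) (a : F) (t : K) :
    aeval t (g.comp (X * (X + C a))) = aeval (t * (t + algebraMap F K a)) g := by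
  simp [aeval_comp]

theorem aeval_derivative_comp_X_mul_X_add_C {F K : Type*} [Field F] [CharP F 2] [Field K]
    [Algebra F K] (g : F[X]) (a : F) (t : K) :
    aeval t (derivative (g.comp (X * (X + C a)))) =
      algebraMap F K a * aeval (t * (t + algebraMap F K a)) (derivative g) := by
  have h : derivative (X * (X + C a) : F[X]) = C a := by
    have h2 : (2 : F[X]) = 0 := CharTwo.two_eq_zero
    simp only [derivative_mul, derivative_X, derivative_add, derivative_C]
    linear_combination X * h2
  rw [derivative_comp, h, map_mul, aeval_comp_X_mul_X_add_C, aeval_C]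

theorem mul_add_eq_mul_add_iff_of_charTwo {K : Type*} [Field K] [CharP K 2] (a s t : K) :
    s * (s + a) = t * (t + a) ↔ s = t ∨ s = t + a := by
  have h2 : (2 : K) = 0 := CharTwo.two_eq_zero
  rw [← sub_eq_zero, ← sub_eq_zero (a := s) (b := t), ← sub_eq_zero (a := s) (b := t + a),
    ← mul_eq_zero]
  have : s * (s + a) - t * (t + a) = (s - t) * (s - (t + a)) := by
    linear_combination (s - t) * (t + a) * h2
  rw [this]

theorem IsAlgClosed.exists_mul_add_eq {K : Type*} [Field K] [IsAlgClosed K] (a c : K) :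
    ∃ t : K, t * (t + a) = c := by
  have hd : (X ^ 2 + C a * X - C c : K[X]).degree ≠ 0 := by
    have : (X ^ 2 + C a * X - C c : K[X]).degree = 2 := by compute_degree!
    rw [this]; decide
  obtain ⟨t, ht⟩ := IsAlgClosed.exists_root _ hd
  refine ⟨t, ?_⟩
  simp only [IsRoot.def, eval_sub, eval_add, eval_pow, eval_X, eval_mul, eval_C] at ht
  linear_combination ht

/-- Let `f ∈ 𝔽_{2^n}[x]` have degree `m ≥ 7` and `α ≠ 0`.  Write `D_α f (x) = f(x+α) - f(x)`.
The polynomial `L_α f` (characterized by `L_α f (x(x+α)) = D_α f (x)` and of degree at most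
`(m-1)/2`) has distinct critical values if and only if: for all `τ, η` in the algebraic
closure of `𝔽_{2^n}`, `(D_α f)'(τ) = (D_α f)'(η) = 0` and `D_α f (τ) = D_α f (η)` imply
`τ = η` or `τ = η + α`. -/
theorem distinct_critical_values_iff_derivative_condition (n m : ℕ) (hm : 7 ≤ m)
    (f : Polynomial (GaloisField 2 n)) (hf : f.natDegree = m)
    (α : GaloisField 2 n) (hα : α ≠ 0)
    (L : Polynomial (GaloisField 2 n)) (hLdeg : L.natDegree ≤ (m - 1) / 2)
    (hL : L.comp (X * (X + C α)) = f.comp (X + C α) - f) :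
    HasDistinctCriticalValues L ↔
      ∀ τ η : AlgebraicClosure (GaloisField 2 n),
        aeval τ (derivative (f.comp (X + C α) - f)) = 0 →
        aeval η (derivative (f.comp (X + C α) - f)) = 0 →
        aeval τ (f.comp (X + C α) - f) = aeval η (f.comp (X + C α) - f) →
        τ = η ∨ τ = η + algebraMap (GaloisField 2 n) (AlgebraicClosure (GaloisField 2 n)) α := by
  have : CharP (AlgebraicClosure (GaloisField 2 n)) 2 :=
    charP_of_injective_algebraMap (algebraMap (GaloisField 2 n) _).injective 2
  have ha : algebraMap (GaloisField 2 n) (AlgebraicClosure (GaloisField 2 n)) α ≠ 0 := by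
    simpa using hα
  simp only [← hL, aeval_derivative_comp_X_mul_X_add_C, aeval_comp_X_mul_X_add_C, mul_eq_zero,
    ha, false_or, ← mul_add_eq_mul_add_iff_of_charTwo]
  refine ⟨fun h τ η => h _ _, fun h τ η => ?_⟩
  obtain ⟨s, rfl⟩ := IsAlgClosed.exists_mul_add_eq (algebraMap (GaloisField 2 n) _ α) τ
  obtain ⟨t, rfl⟩ := IsAlgClosed.exists_mul_add_eq (algebraMap (GaloisField 2 n) _ α) η
  exact h s t
end
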